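/- lim_{n→∞} depth R/(I+J)^n = min { lim_{i→∞} depth A/I^i + min_{j ≥ 1} depth B/J^j , min_{i ≥ 1} depth A/I^i + lim_{j→∞} depth B/J^j }. (Here the limits exist since, by Brodmann's theorem, the depth of the quotient by powers of a homogeneous ideal is constant for large powers.) -/

import Mathlib

/-! Core definitions: depth via local cohomology at the maximal homogeneous ideal,
Castelnuovo–Mumford regularity via graded free resolutions, gradings on
subquotients of polynomial rings.  -/

open MvPolynomial

noncomputable section

namespace PaperHTT

variable (k : Type) [Field k]

/-- A polynomial is homogeneous of degree `e : ℤ` (it must vanish in negative degrees). -/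
def homogZ {σ : Type} (p : MvPolynomial σ k) (e : ℤ) : Prop :=
  p = 0 ∨ (0 ≤ e ∧ p.IsHomogeneous e.toNat)

/-- The maximal homogeneous ideal `(x_1, …, x_r)` of a polynomial ring. -/
def maxHomIdeal (σ : Type) : Ideal (MvPolynomial σ k) :=
  Ideal.span (Set.range MvPolynomial.X)

/-- The depth of a module over a polynomial ring with respect to the maximal homogeneous
ideal: the least `i` such that the `i`-th local cohomology is non-vanishing. -/
def depthM {σ : Type} (M : ModuleCat (MvPolynomial σ k)) : ℕ :=
  sInf {i : ℕ | Nontrivial ((localCohomology (maxHomIdeal k σ) i).obj M)}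

/-- The subquotient `p/q` of a polynomial ring, for ideals `q ≤ p`. -/
abbrev subQuot {σ : Type} (p q : Ideal (MvPolynomial σ k)) : Type :=
  ↥p ⧸ (Submodule.comap p.subtype q)

/-- The degree-`t` graded piece of `p/q`: the image of the homogeneous elements of
degree `t` of `p`. -/
def subQuotGr {σ : Type} (p q : Ideal (MvPolynomial σ k)) (t : ℤ) :
    AddSubgroup (subQuot k p q) :=
  AddSubgroup.closure
    {x | ∃ f : p, homogZ k (f : MvPolynomial σ k) t ∧ x = Submodule.Quotient.mk f}

/-- The degree-`t` graded piece of the quotient ring `P/Q`. -/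
def quotGr {σ : Type} (Q : Ideal (MvPolynomial σ k)) (t : ℤ) :
    AddSubgroup (MvPolynomial σ k ⧸ Q) :=
  AddSubgroup.closure {x | ∃ f, homogZ k f t ∧ x = Ideal.Quotient.mk Q f}

/-- The degree-`t` graded piece of an ideal `p`, viewed as a module. -/
def idealGr {σ : Type} (p : Ideal (MvPolynomial σ k)) (t : ℤ) : AddSubgroup ↥p :=
  AddSubgroup.closure {x : p | homogZ k (x : MvPolynomial σ k) t}

/-- A finite graded free resolution of a module `M` over a polynomial ring,
with respect to a grading `gr` of `M`: `F_i` is free of rank `rk i`, with basis elements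
of (twisted) degrees `tw i l`, the differentials and augmentation are graded of degree `0`,
and the complex `⋯ → F_1 → F_0 → M → 0` is exact. -/
structure GradedFreeRes (σ : Type) (M : Type) [AddCommGroup M]
    [Module (MvPolynomial σ k) M] (gr : ℤ → AddSubgroup M) where
  rk : ℕ → ℕ
  tw : (i : ℕ) → Fin (rk i) → ℤ
  bdd : ∃ N, ∀ i, N ≤ i → rk i = 0
  aug : (Fin (rk 0) → MvPolynomial σ k) →ₗ[MvPolynomial σ k] M
  d : (i : ℕ) →
    ((Fin (rk (i + 1)) → MvPolynomial σ k) →ₗ[MvPolynomial σ k]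
      (Fin (rk i) → MvPolynomial σ k))
  aug_surj : Function.Surjective aug
  exact_zero : LinearMap.range (d 0) = LinearMap.ker aug
  exact_succ : ∀ i, LinearMap.range (d (i + 1)) = LinearMap.ker (d i)
  aug_homog : ∀ l, aug (Pi.single l 1) ∈ gr (tw 0 l)
  d_homog : ∀ i l l', homogZ k (d i (Pi.single l 1) l') (tw (i + 1) l - tw i l')

/-- The Castelnuovo–Mumford regularity of a (finitely generated) graded module over a
polynomial ring: the least `r` such that `M` admits a graded free resolution with all
twists in homological degree `i` at most `r + i`.  (By minimal free resolutions, this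
agrees with `max {aⁱ(M) + i}`.) -/
def regM (σ : Type) (M : Type) [AddCommGroup M] [Module (MvPolynomial σ k) M]
    (gr : ℤ → AddSubgroup M) : ℤ :=
  sInf {r : ℤ | ∃ F : GradedFreeRes k σ M gr, ∀ i (l : Fin (F.rk i)), F.tw i l - (i : ℤ) ≤ r}

/-- Depth of the quotient ring `P/Q` as a module over `P`. -/
def depthQuot {σ : Type} (Q : Ideal (MvPolynomial σ k)) : ℕ :=
  depthM k (ModuleCat.of (MvPolynomial σ k) (MvPolynomial σ k ⧸ Q))

/-- Depth of the subquotient `p/q` as a module over the polynomial ring. -/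
def depthSubQuot {σ : Type} (p q : Ideal (MvPolynomial σ k)) : ℕ :=
  depthM k (ModuleCat.of (MvPolynomial σ k) (subQuot k p q))

/-- Depth of an ideal `p` as a module over the polynomial ring. -/
def depthIdeal {σ : Type} (p : Ideal (MvPolynomial σ k)) : ℕ :=
  depthM k (ModuleCat.of (MvPolynomial σ k) ↥p)

/-- Regularity of the quotient ring `P/Q`. -/
def regQuot {σ : Type} (Q : Ideal (MvPolynomial σ k)) : ℤ :=
  regM k σ (MvPolynomial σ k ⧸ Q) (quotGr k Q)

/-- Regularity of the subquotient `p/q`. -/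
def regSubQuot {σ : Type} (p q : Ideal (MvPolynomial σ k)) : ℤ :=
  regM k σ (subQuot k p q) (subQuotGr k p q)

/-- Regularity of an ideal `p`, viewed as a graded module. -/
def regIdeal {σ : Type} (p : Ideal (MvPolynomial σ k)) : ℤ :=
  regM k σ (↥p) (idealGr k p)

/-- A homogeneous ideal: one containing all homogeneous components of its elements. -/
def IsHomogeneousIdeal {σ : Type} (I : Ideal (MvPolynomial σ k)) : Prop :=
  ∀ f ∈ I, ∀ m : ℕ, MvPolynomial.homogeneousComponent m f ∈ I

/-- A monomial ideal. -/
def IsMonomialIdeal {σ : Type} (I : Ideal (MvPolynomial σ k)) : Prop :=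
  ∃ S : Set (σ →₀ ℕ), I = Ideal.span ((fun a => MvPolynomial.monomial a (1 : k)) '' S)

/-- A squarefree monomial ideal. -/
def IsSquarefreeMonomialIdeal {σ : Type} (I : Ideal (MvPolynomial σ k)) : Prop :=
  ∃ S : Set (σ →₀ ℕ), (∀ a ∈ S, ∀ x, a x ≤ 1) ∧
    I = Ideal.span ((fun a => MvPolynomial.monomial a (1 : k)) '' S)


/-- The quotient ring `P/Q` is Cohen–Macaulay: its depth equals its Krull dimension. -/
def IsCMQuot {σ : Type} (Q : Ideal (MvPolynomial σ k)) : Prop :=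
  (depthQuot k Q : WithBot (WithTop ℕ)) = ringKrullDim (MvPolynomial σ k ⧸ Q)

/-- An isomorphism of graded modules: a linear isomorphism matching up the gradings. -/
def GradedIso {P : Type} [CommRing P] {M N : Type} [AddCommGroup M] [Module P M]
    [AddCommGroup N] [Module P N] (grM : ℤ → AddSubgroup M) (grN : ℤ → AddSubgroup N) :
    Prop :=
  ∃ e : M ≃ₗ[P] N, ∀ t, (grM t).map e.toLinearMap.toAddMonoidHom = grN t

/-- `gr` is an (internal, ℤ-) grading of the module `M` over a polynomial ring,
compatible with the standard grading of the polynomial ring. -/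
def IsGrading (σ : Type) {M : Type} [AddCommGroup M] [Module (MvPolynomial σ k) M]
    (gr : ℤ → AddSubgroup M) : Prop :=
  DirectSum.IsInternal (fun t : ℤ => gr t) ∧
    ∀ (p : MvPolynomial σ k) (d : ℕ) (t : ℤ) (m : M), p.IsHomogeneous d → m ∈ gr t →
      p • m ∈ gr (t + d)

/-- The polynomial ring `A = k[x_1,…,x_r]`. -/
abbrev PA (r : ℕ) : Type := MvPolynomial (Fin r) k

/-- The polynomial ring `B = k[y_1,…,y_s]`. -/
abbrev PB (s : ℕ) : Type := MvPolynomial (Fin s) k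

/-- The polynomial ring `R = k[x_1,…,x_r,y_1,…,y_s]`. -/
abbrev PR (r s : ℕ) : Type := MvPolynomial (Fin r ⊕ Fin s) k

/-- The extension of an ideal `I ⊆ A` to `R`. -/
def extA {r s : ℕ} (I : Ideal (PA k r)) : Ideal (PR k r s) :=
  I.map (MvPolynomial.rename (Sum.inl : Fin r → Fin r ⊕ Fin s))

/-- The extension of an ideal `J ⊆ B` to `R`. -/
def extB {r s : ℕ} (J : Ideal (PB k s)) : Ideal (PR k r s) :=
  J.map (MvPolynomial.rename (Sum.inr : Fin s → Fin r ⊕ Fin s))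

/-- The ideal `I + J ⊆ R`. -/
def sumIJ {r s : ℕ} (I : Ideal (PA k r)) (J : Ideal (PB k s)) : Ideal (PR k r s) :=
  extA k I + extB k J

end PaperHTT

end

namespace PaperHTT

open CategoryTheory Abelian Pointwise Limits

/-- `M` has an `M`-regular sequence of length `d` in `m` such that the quotient of `M` by it
contains a nonzero element annihilated by `m`. -/
def HasDepth {R : Type} [CommRing R] (m : Ideal R) :
    ℕ → ∀ (M : Type) [AddCommGroup M] [Module R M], Prop
  | 0, M, _, _ => ∃ s : M, s ≠ 0 ∧ ∀ a ∈ m, a • s = 0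
  | d + 1, M, _, _ => ∃ x ∈ m, IsSMulRegular M x ∧ HasDepth m d (QuotSMulTop x M)

section HasDepth

variable {R : Type} [CommRing R] {m : Ideal R}

lemma HasDepth.congr {d : ℕ} {M N : Type} [AddCommGroup M] [Module R M] [AddCommGroup N]
    [Module R N] (e : M ≃ₗ[R] N) (h : HasDepth m d M) : HasDepth m d N := by
  induction d generalizing M N with
  | zero =>
    obtain ⟨s, hs, h⟩ := h
    refine ⟨e s, by simpa using hs, fun a ha => ?_⟩
    rw [← map_smul, h a ha, map_zero]
  | succ d ih =>
    obtain ⟨x, hx, hr, h⟩ := h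
    exact ⟨x, hx, (e.isSMulRegular_congr x).mp hr, ih (QuotSMulTop.congr x e) h⟩

lemma HasDepth.nontrivial {d : ℕ} {M : Type} [AddCommGroup M] [Module R M]
    (h : HasDepth m d M) : Nontrivial M := by
  induction d generalizing M with
  | zero =>
    obtain ⟨s, hs, -⟩ := h
    exact nontrivial_of_ne _ _ hs
  | succ d ih =>
    obtain ⟨x, hx, hr, h⟩ := h
    have := ih h
    exact (Submodule.mkQ_surjective (x • (⊤ : Submodule R M))).nontrivial

/-- The modules `Ext^i(R/m, M)` vanish for `i < d`, but not for `i = d`. -/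
def ExtDepth (m : Ideal R) (M : ModuleCat.{0} R) (d : ℕ) : Prop :=
  (∀ i < d, Subsingleton (Ext (ModuleCat.of R (R ⧸ m)) M i)) ∧
    Nontrivial (Ext (ModuleCat.of R (R ⧸ m)) M d)

lemma ExtDepth.unique {M : ModuleCat.{0} R} {d e : ℕ} (h : ExtDepth m M d)
    (h' : ExtDepth m M e) : d = e := by
  rcases lt_trichotomy d e with hlt | rfl | hlt
  · exact (not_subsingleton_iff_nontrivial.mpr h.2 (h'.1 d hlt)).elim
  · rfl
  · exact (not_subsingleton_iff_nontrivial.mpr h'.2 (h.1 e hlt)).elim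

lemma ext_smul_eq_zero {M : ModuleCat.{0} R} {x : R} (hx : x ∈ m) (i : ℕ)
    (α : Ext (ModuleCat.of R (R ⧸ m)) M i) :
    α.comp (Ext.mk₀ (x • 𝟙 M)) (add_zero i) = 0 := by
  have : x • 𝟙 (ModuleCat.of R (R ⧸ m)) = 0 := by
    rw [← ModuleCat.lsmul_eq_smul_id, Module.mem_annihilator_iff_lsmul_eq_zero.mp
      (by simpa [Ideal.annihilator_quotient] using hx)]
    rfl
  rw [← Ext.smul_eq_comp_mk₀, ← Ext.mk₀_id_comp α, ← Ext.smul_comp, ← Ext.mk₀_smul, this]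
  simp

lemma HasDepth.extDepth {d : ℕ} {M : Type} [AddCommGroup M] [Module R M]
    (h : HasDepth m d M) : ExtDepth m (ModuleCat.of R M) d := by
  induction d generalizing M with
  | zero =>
    refine ⟨by simp, ?_⟩
    obtain ⟨s, hs, h⟩ := h
    let f : (R ⧸ m) →ₗ[R] M := Submodule.liftQ m (LinearMap.toSpanSingleton R M s)
      (fun a ha => by simpa using h a ha)
    have hf : f ≠ 0 := fun h0 => hs <| by
      have := LinearMap.congr_fun h0 (Submodule.Quotient.mk 1)
      rwa [Submodule.liftQ_apply, LinearMap.toSpanSingleton_apply, one_smul] at this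
    rw [((Ext.addEquiv₀).trans ModuleCat.homAddEquiv).toEquiv.nontrivial_congr]
    exact nontrivial_of_ne f 0 hf
  | succ d ih =>
    obtain ⟨x, hx, hr, h⟩ := h
    have hS : ((ModuleCat.of R M).smulShortComplex x).ShortExact :=
      IsSMulRegular.smulShortComplex_shortExact hr
    obtain ⟨h1, h2⟩ := ih h
    change ∀ i < d, Subsingleton (Ext (ModuleCat.of R (R ⧸ m))
      ((ModuleCat.of R M).smulShortComplex x).X₃ i) at h1
    change Nontrivial (Ext (ModuleCat.of R (R ⧸ m))
      ((ModuleCat.of R M).smulShortComplex x).X₃ d) at h2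
    have inj : ∀ i ≤ d, ∀ a : Ext (ModuleCat.of R (R ⧸ m)) (ModuleCat.of R M) i, a = 0 := by
      rintro (_ | i) hi a
      · have : Mono (x • 𝟙 (ModuleCat.of R M)) := hS.mono_f
        have h0 := ext_smul_eq_zero hx 0 a
        obtain ⟨f, rfl⟩ := Ext.homEquiv₀.symm.surjective a
        rw [Ext.homEquiv₀_symm_apply, Ext.mk₀_comp_mk₀, Ext.mk₀_eq_zero_iff] at h0
        rw [Limits.zero_of_comp_mono _ h0]
        simp
      · obtain ⟨y, rfl⟩ := Ext.covariant_sequence_exact₁ _ hS a (ext_smul_eq_zero hx _ a)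
          (n₀ := i) rfl
        have := h1 i (by omega)
        rw [Subsingleton.elim y 0, Ext.zero_comp]
        rfl
    refine ⟨fun i hi => ⟨fun a b => ?_⟩, ?_⟩
    · rw [inj i (by omega) a, inj i (by omega) b]
    obtain ⟨y, hy⟩ := exists_ne (0 : Ext (ModuleCat.of R (R ⧸ m))
      ((ModuleCat.of R M).smulShortComplex x).X₃ d)
    refine nontrivial_of_ne (y.comp hS.extClass rfl) 0 fun h0 => hy ?_
    obtain ⟨z, rfl⟩ := Ext.covariant_sequence_exact₃ _ hS y rfl h0
    have : z = 0 := inj d le_rfl z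
    rw [this, Ext.zero_comp]

end HasDepth

section Cocycles

variable {R : Type} [CommRing R] {m : Ideal R}

/-- The cohomology of `Hom(P, M)` vanishes in degree `i`: all cocycles are coboundaries. -/
def CocyclesVanish {X : ModuleCat.{0} R} (P : ProjectiveResolution X) (M : ModuleCat.{0} R)
    (i : ℕ) : Prop :=
  ∀ f : P.complex.X i ⟶ M, P.complex.d (i + 1) i ≫ f = 0 →
    ∃ (j : ℕ) (g : P.complex.X j ⟶ M), f = P.complex.d i j ≫ g

lemma exists_smul_coboundary {X : ModuleCat.{0} R} (P : ProjectiveResolution X)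
    {M : ModuleCat.{0} R} {i : ℕ} (f : P.complex.X i ⟶ M) (hf : P.complex.d (i + 1) i ≫ f = 0)
    {x : R} (hx : x • 𝟙 X = 0) :
    ∃ (j : ℕ) (g : P.complex.X j ⟶ M), x • f = P.complex.d i j ≫ g := by
  let H : Homotopy (x • 𝟙 P.complex) 0 := ProjectiveResolution.liftHomotopyZero (P := P) (Q := P)
    (x • 𝟙 P.complex) (by
      have : x • P.π = P.π ≫ (ChainComplex.single₀ (ModuleCat R)).map (x • 𝟙 X) := by
        ext1
        simp
        rfl
      rw [Linear.smul_comp, Category.id_comp, this, hx]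
      simp)
  have h := H.comm i
  refine ⟨(ComplexShape.down ℕ).next i, H.hom _ i ≫ f, ?_⟩
  calc x • f = (x • 𝟙 P.complex : P.complex ⟶ P.complex).f i ≫ f := by simp
    _ = _ := by
      rw [h]
      simp only [dNext, prevD, AddMonoidHom.mk'_apply, HomologicalComplex.zero_f, add_zero,
        Preadditive.add_comp, Category.assoc]
      have : P.complex.d ((ComplexShape.down ℕ).prev i) i ≫ f = 0 := by
        rw [ChainComplex.prev, hf]
      rw [this, comp_zero, add_zero]

/-- The properties of the short exact sequence `0 → M → M → N → 0`, with multiplication by `x`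
as the first map, that are used in dimension shifting. -/
structure IsSMulCokernel (x : R) {M N : ModuleCat.{0} R} (π : M ⟶ N) : Prop where
  epi : Epi π
  smul_eq_zero : x • π = 0
  exists_smul {A : ModuleCat.{0} R} (f : A ⟶ M) : f ≫ π = 0 → ∃ g, f = x • g
  eq_zero {A : ModuleCat.{0} R} (f : A ⟶ M) : x • f = 0 → f = 0

lemma isSMulCokernel {M : Type} [AddCommGroup M] [Module R M] {x : R} (hx : IsSMulRegular M x) :
    IsSMulCokernel x (M := ModuleCat.of R M) (N := ModuleCat.of R (QuotSMulTop x M))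
      (ModuleCat.ofHom (Submodule.mkQ _)) := by
  refine ⟨?_, ?_, fun {A} f hf => ?_, fun {A} f hf => ?_⟩
  · rw [ModuleCat.epi_iff_surjective]
    exact Submodule.mkQ_surjective _
  · ext a
    exact (Submodule.Quotient.mk_eq_zero _).mpr (Submodule.smul_mem_pointwise_smul a x ⊤ trivial)
  · have hS : ((ModuleCat.of R M).smulShortComplex x).ShortExact :=
      IsSMulRegular.smulShortComplex_shortExact hx
    have := hS.mono_f
    let g : A ⟶ ModuleCat.of R M := hS.exact.lift f hf
    have hg : g ≫ (x • 𝟙 (ModuleCat.of R M)) = f := hS.exact.lift_f f hf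
    exact ⟨g, by rw [← hg, Linear.comp_smul, Category.comp_id]⟩
  · ext a
    exact hx ((congrArg (fun f => f.hom a) hf).trans (smul_zero x).symm)

lemma IsSMulCokernel.exists_coboundary {X : ModuleCat.{0} R} (P : ProjectiveResolution X)
    {M N : ModuleCat.{0} R} {x : R} {π : M ⟶ N} (hπ : IsSMulCokernel x π) {i : ℕ}
    (hN : ∀ j < i, CocyclesVanish P N j) (f : P.complex.X i ⟶ M)
    (hf : ∃ (j : ℕ) (g : P.complex.X j ⟶ M), x • f = P.complex.d i j ≫ g) :
    ∃ (j : ℕ) (g : P.complex.X j ⟶ M), f = P.complex.d i j ≫ g := by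
  have := hπ.epi
  obtain ⟨j, g, hg⟩ := hf
  by_cases hij : j + 1 = i
  · subst hij
    obtain ⟨l, h, hh⟩ := hN j (by omega) (g ≫ π) (by
      rw [← Category.assoc, ← hg, Linear.smul_comp, ← Linear.comp_smul, hπ.smul_eq_zero,
        comp_zero])
    obtain ⟨g', hg'⟩ := hπ.exists_smul (g - P.complex.d j l ≫ Projective.factorThru h π) (by
      simp [hh])
    refine ⟨j, g', ?_⟩
    rw [← sub_eq_zero]
    apply hπ.eq_zero
    rw [smul_sub, hg, ← Linear.comp_smul, ← hg']
    simp
  · refine ⟨i, 0, ?_⟩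
    rw [comp_zero]
    apply hπ.eq_zero
    rw [hg, P.complex.shape _ _ hij, zero_comp]

lemma HasDepth.cocyclesVanish {d : ℕ} {M : Type} [AddCommGroup M] [Module R M]
    (h : HasDepth m d M) {X : ModuleCat.{0} R} (P : ProjectiveResolution X) {t : ℕ}
    (hX : ∀ x ∈ m ^ t, x • 𝟙 X = 0) {i : ℕ} (hi : i < d) :
    CocyclesVanish P (ModuleCat.of R M) i := by
  induction d generalizing M i with
  | zero => omega
  | succ d ih =>
    obtain ⟨x, hx, hr, h⟩ := h
    intro f hf
    have key : ∀ s : ℕ, (∃ (j : ℕ) (g : P.complex.X j ⟶ ModuleCat.of R M),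
        x ^ s • f = P.complex.d i j ≫ g) →
        ∃ (j : ℕ) (g : P.complex.X j ⟶ ModuleCat.of R M), f = P.complex.d i j ≫ g := by
      intro s
      induction s with
      | zero => simp
      | succ s ihs =>
        intro hs
        apply ihs
        refine (isSMulCokernel hr).exists_coboundary P (fun j hj => ih h (by omega)) (x ^ s • f) ?_
        rwa [smul_smul, ← pow_succ']
    exact key t (exists_smul_coboundary P f hf (hX _ (Ideal.pow_mem_pow hx t)))

lemma HasDepth.exists_cocycle {d : ℕ} {M : Type} [AddCommGroup M] [Module R M]
    (h : HasDepth m d M) (Q : ProjectiveResolution (ModuleCat.of R (R ⧸ m))) :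
    ∃ f : Q.complex.X d ⟶ ModuleCat.of R M, Q.complex.d (d + 1) d ≫ f = 0 ∧
      ∀ (X : ModuleCat.{0} R) (p : X ⟶ ModuleCat.of R (R ⧸ m)) [Epi p] (t : ℕ)
        (_ : ∀ x ∈ m ^ t, x • 𝟙 X = 0) (P : ProjectiveResolution X) (j : ℕ)
        (g : P.complex.X j ⟶ ModuleCat.of R M),
        (ProjectiveResolution.lift p P Q).f d ≫ f ≠ P.complex.d d j ≫ g := by
  induction d generalizing M with
  | zero =>
    obtain ⟨s, hs, h⟩ := h
    let l : (R ⧸ m) →ₗ[R] M := Submodule.liftQ m (LinearMap.toSpanSingleton R M s)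
      (fun a ha => by simpa using h a ha)
    have hl : ModuleCat.ofHom l ≠ 0 := fun h0 => hs <| by
      have := congrArg (fun f => f.hom (Submodule.Quotient.mk 1)) h0
      rwa [ModuleCat.hom_ofHom, Submodule.liftQ_apply, LinearMap.toSpanSingleton_apply,
        one_smul] at this
    let ε : Q.complex.X 0 ⟶ ModuleCat.of R (R ⧸ m) := Q.π.f 0
    have hε : Q.complex.d 1 0 ≫ ε = 0 := Q.complex_d_comp_π_f_zero
    refine ⟨ε ≫ ModuleCat.ofHom l, by rw [← Category.assoc, hε, zero_comp],
      fun X p _ t _ P j g hg => hl ?_⟩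
    rw [P.complex.shape 0 j (by simp), zero_comp, ← Category.assoc] at hg
    let ε' : P.complex.X 0 ⟶ X := P.π.f 0
    have hε' : Epi ε' := inferInstanceAs (Epi (P.π.f 0))
    have h2 : (ProjectiveResolution.lift p P Q).f 0 ≫ ε = ε' ≫ p :=
      ProjectiveResolution.lift_commutes_zero p P Q
    rw [h2, Category.assoc] at hg
    exact zero_of_epi_comp p (zero_of_epi_comp ε' hg)
  | succ d ih =>
    have hM := h
    obtain ⟨x, hx, hr, h⟩ := h
    obtain ⟨f, hf, hf'⟩ := ih h
    have hπ := isSMulCokernel hr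
    set π : ModuleCat.of R M ⟶ ModuleCat.of R (QuotSMulTop x M) :=
      ModuleCat.ofHom (Submodule.mkQ _)
    have := hπ.epi
    obtain ⟨f', rfl⟩ : ∃ f', f = f' ≫ π := ⟨_, (Projective.factorThru_comp f π).symm⟩
    obtain ⟨q, hq⟩ := hπ.exists_smul (Q.complex.d (d + 1) d ≫ f') (by rw [Category.assoc, hf])
    refine ⟨q, hπ.eq_zero _ ?_, fun X p _ t hX P j g hg => ?_⟩
    · rw [← Linear.comp_smul, ← hq]
      simp
    obtain ⟨g, hg⟩ : ∃ g, (ProjectiveResolution.lift p P Q).f (d + 1) ≫ q =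
        P.complex.d (d + 1) d ≫ g := by
      by_cases hj : j = d
      · subst hj
        exact ⟨g, hg⟩
      · refine ⟨0, ?_⟩
        rw [hg, P.complex.shape _ _ (by simpa using hj)]
        simp
    obtain ⟨l, g', hg'⟩ := hM.cocyclesVanish P hX (Nat.lt_succ_self d)
      ((ProjectiveResolution.lift p P Q).f d ≫ f' - x • g) (by
        rw [Preadditive.comp_sub, ← Category.assoc, ← HomologicalComplex.Hom.comm,
          Category.assoc, hq, Linear.comp_smul, hg, Linear.comp_smul, sub_self])
    refine hf' X p t hX P l (g' ≫ π) ?_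
    rw [← Category.assoc, ← Category.assoc, ← hg', Preadditive.sub_comp, Linear.smul_comp,
      ← Linear.comp_smul, hπ.smul_eq_zero, comp_zero, sub_zero]

end Cocycles

section LocalCohomology

variable {R : Type} [CommRing R] {m : Ideal R}

/-- The morphism of cochain complexes `Hom(Q, M) ⟶ Hom(P, M)` induced by a chain map `P ⟶ Q`. -/
noncomputable def linearYonedaMap {K L : ChainComplex (ModuleCat.{0} R) ℕ} (φ : K ⟶ L)
    (M : ModuleCat.{0} R) : L.linearYonedaObj R M ⟶ K.linearYonedaObj R M :=
  (HomologicalComplex.unopFunctor _ _).map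
    (((((linearYoneda R (ModuleCat.{0} R)).obj M).rightOp.mapHomologicalComplex _).map φ).op)

lemma inv_comp_eq_comp_inv {C : Type*} [Category* C] {X X' Y Y' : C} {i : X ≅ X'} {j : Y ≅ Y'}
    {f : X ⟶ Y} {g : X' ⟶ Y'} (h : f ≫ j.hom = i.hom ≫ g) : i.inv ≫ f = g ≫ j.inv := by
  rw [Iso.inv_comp_eq, ← Category.assoc, Iso.eq_comp_inv, h]

lemma isoExt_naturality {X Y : ModuleCat.{0} R} (p : X ⟶ Y) (P : ProjectiveResolution X)
    (Q : ProjectiveResolution Y) (M : ModuleCat.{0} R) (i : ℕ) :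
    ((_root_.Ext R (ModuleCat.{0} R) i).map p.op).app M ≫ (P.isoExt i M).hom =
      (Q.isoExt i M).hom ≫
        HomologicalComplex.homologyMap (linearYonedaMap (ProjectiveResolution.lift p P Q) M) i := by
  have h1 := ProjectiveResolution.isoLeftDerivedObj_hom_naturality p P Q
    (ProjectiveResolution.lift p P Q) (ProjectiveResolution.lift_commutes_zero p P Q)
    ((linearYoneda R (ModuleCat.{0} R)).obj M).rightOp i
  have h2 := HomologicalComplex.homologyOp_hom_naturality
    (linearYonedaMap (ProjectiveResolution.lift p P Q) M) i
  have h3 := congrArg Quiver.Hom.unop (inv_comp_eq_comp_inv h1)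
  have h4 := congrArg Quiver.Hom.unop (inv_comp_eq_comp_inv h2)
  change ((((linearYoneda R (ModuleCat.{0} R)).obj M).rightOp.leftDerived i).map p).unop ≫
    (P.isoLeftDerivedObj ((linearYoneda R (ModuleCat.{0} R)).obj M).rightOp i).inv.unop ≫ _ =
    ((Q.isoLeftDerivedObj ((linearYoneda R (ModuleCat.{0} R)).obj M).rightOp i).inv.unop ≫ _) ≫ _
  rw [← Category.assoc, Category.assoc _ _ (HomologicalComplex.homologyMap _ i)]
  refine (congrArg (· ≫ _) h3).trans ?_
  refine (Category.assoc _ _ _).trans ?_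
  exact congrArg (_ ≫ ·) h4

lemma CocyclesVanish.isZero_ext {X : ModuleCat.{0} R} {P : ProjectiveResolution X}
    {M : ModuleCat.{0} R} {i : ℕ} (h : CocyclesVanish P M i) :
    IsZero (((_root_.Ext R (ModuleCat.{0} R) i).obj (Opposite.op X)).obj M) := by
  refine IsZero.of_iso ?_ (P.isoExt i M)
  rw [← HomologicalComplex.exactAt_iff_isZero_homology,
    HomologicalComplex.exactAt_iff' _ _ i (i + 1) rfl (CochainComplex.next ℕ i),
    ShortComplex.moduleCat_exact_iff]
  intro f hf
  obtain ⟨j, g, hg⟩ := h f hf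
  by_cases hj : j + 1 = i
  · obtain rfl : (ComplexShape.up ℕ).prev i = j := (ComplexShape.up ℕ).prev_eq' hj
    exact ⟨g, hg.symm⟩
  · refine ⟨0, ?_⟩
    rw [map_zero]
    exact (hg.trans (by rw [P.complex.shape _ _ hj, zero_comp]; rfl)).symm

lemma exists_ext_ne_zero {Y : ModuleCat.{0} R} (Q : ProjectiveResolution Y) {M : ModuleCat.{0} R}
    {i : ℕ} (f : Q.complex.X i ⟶ M) (hf : Q.complex.d (i + 1) i ≫ f = 0) :
    ∃ e : ((_root_.Ext R (ModuleCat.{0} R) i).obj (Opposite.op Y)).obj M,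
      ∀ (X : ModuleCat.{0} R) (p : X ⟶ Y) (P : ProjectiveResolution X),
        (∀ (j : ℕ) (g : P.complex.X j ⟶ M),
          (ProjectiveResolution.lift p P Q).f i ≫ f ≠ P.complex.d i j ≫ g) →
        (((_root_.Ext R (ModuleCat.{0} R) i).map p.op).app M).hom e ≠ 0 := by
  let γ : ModuleCat.of R R ⟶ (Q.complex.linearYonedaObj R M).X i :=
    ModuleCat.ofHom (LinearMap.toSpanSingleton R (Q.complex.X i ⟶ M) f)
  have hγ : γ ≫ (Q.complex.linearYonedaObj R M).d i (i + 1) = 0 := by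
    ext
    exact (congrArg (Q.complex.d (i + 1) i ≫ ·) (one_smul R f)).trans hf
  let e₀ := (Q.complex.linearYonedaObj R M).liftCycles γ (i + 1) (CochainComplex.next ℕ i) hγ ≫
    (Q.complex.linearYonedaObj R M).homologyπ i ≫ (Q.isoExt i M).inv
  refine ⟨e₀.hom 1, fun X p P h h0 => ?_⟩
  have h1 : e₀ ≫ ((_root_.Ext R (ModuleCat.{0} R) i).map p.op).app M = 0 := by
    ext
    exact h0
  have h2 : e₀ ≫ ((_root_.Ext R (ModuleCat.{0} R) i).map p.op).app M ≫ (P.isoExt i M).hom = 0 := by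
    rw [← Category.assoc, h1, zero_comp]
  rw [isoExt_naturality p P Q] at h2
  simp only [e₀, Category.assoc, Iso.inv_hom_id_assoc] at h2
  rw [HomologicalComplex.homologyπ_naturality, HomologicalComplex.liftCycles_comp_cyclesMap_assoc,
    HomologicalComplex.liftCycles_comp_homologyπ_eq_zero_iff_up_to_refinements _ _ _ _ rfl] at h2
  obtain ⟨A, π, hπ, x, hx⟩ := h2
  obtain ⟨a, ha⟩ := (ModuleCat.epi_iff_surjective π).mp hπ 1
  refine h _ (x.hom a) ?_
  have := congrArg (fun f => f.hom a) hx
  refine Eq.trans ?_ this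
  change _ = (ProjectiveResolution.lift p P Q).f i ≫ (π.hom a • f)
  erw [ha, one_smul]

/-- The colimit cocone exhibiting the local cohomology of `M` as a colimit of `Ext` modules. -/
noncomputable def localCohomologyIsColimit (m : Ideal R) (i : ℕ) (M : ModuleCat.{0} R) :
    IsColimit (((evaluation _ _).obj M).mapCocone
      (colimit.cocone (localCohomology.diagram (localCohomology.idealPowersDiagram m) i))) :=
  isColimitOfPreserves _ (colimit.isColimit _)

lemma smul_id_quotient_eq_zero (I : Ideal R) {x : R} (hx : x ∈ I) :
    x • 𝟙 (ModuleCat.of R (R ⧸ I)) = 0 := by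
  rw [← ModuleCat.lsmul_eq_smul_id, Module.mem_annihilator_iff_lsmul_eq_zero.mp
    (by simpa [Ideal.annihilator_quotient] using hx)]
  rfl

lemma HasDepth.localCohomology_subsingleton {d : ℕ} {M : Type} [AddCommGroup M] [Module R M]
    (h : HasDepth m d M) {i : ℕ} (hi : i < d) :
    Subsingleton ((localCohomology m i).obj (ModuleCat.of R M)) := by
  have hc := localCohomologyIsColimit m i (ModuleCat.of R M)
  have key : ∀ x : (localCohomology m i).obj (ModuleCat.of R M), x = 0 := by
    intro x
    obtain ⟨t, y, hy⟩ := Concrete.isColimit_exists_rep _ hc x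
    have hz : IsZero (((_root_.Ext R (ModuleCat.{0} R) i).obj
      (Opposite.op (ModuleCat.of R (R ⧸ m ^ t.unop.unop)))).obj (ModuleCat.of R M)) :=
      (h.cocyclesVanish (projectiveResolution _) (t := t.unop.unop)
        (fun x hx => smul_id_quotient_eq_zero _ hx) hi).isZero_ext
    have : y = 0 := @Subsingleton.elim _ (ModuleCat.subsingleton_of_isZero hz) y 0
    rw [← hy, this]
    exact map_zero _
  exact ⟨fun a b => (key a).trans (key b).symm⟩

lemma HasDepth.localCohomology_nontrivial {d : ℕ} {M : Type} [AddCommGroup M] [Module R M]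
    (h : HasDepth m d M) :
    Nontrivial ((localCohomology m d).obj (ModuleCat.of R M)) := by
  have hc := localCohomologyIsColimit m d (ModuleCat.of R M)
  have hm1 : m ^ 1 = m := pow_one m
  have h' : HasDepth (m ^ 1) d M := by rwa [hm1]
  let Y := ModuleCat.of R (R ⧸ m ^ 1)
  obtain ⟨f, hf, hf'⟩ := h'.exists_cocycle (projectiveResolution Y)
  obtain ⟨e, he⟩ := exists_ext_ne_zero (projectiveResolution Y) f hf
  let D := localCohomology.diagram (localCohomology.idealPowersDiagram m) d
  let one : ℕᵒᵖᵒᵖ := Opposite.op (Opposite.op 1)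
  let e' : (D ⋙ (evaluation _ _).obj (ModuleCat.of R M)).obj one := e
  let c := ((evaluation _ _).obj (ModuleCat.of R M)).mapCocone (colimit.cocone D)
  refine nontrivial_of_ne ((c.ι.app one).hom e') 0 fun h0 => ?_
  obtain ⟨t, u, v, huv⟩ := (Concrete.isColimit_rep_eq_iff_exists _ hc e' 
    (0 : (D ⋙ (evaluation _ _).obj (ModuleCat.of R M)).obj one)).mp (h0.trans (map_zero _).symm)
  let p : ModuleCat.of R (R ⧸ m ^ t.unop.unop) ⟶ Y := 
    (localCohomology.ringModIdeals (localCohomology.idealPowersDiagram m)).map u.unop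
  have hp : Epi p := by
    rw [ModuleCat.epi_iff_surjective]
    intro y
    obtain ⟨y, rfl⟩ := Submodule.Quotient.mk_surjective _ y
    exact ⟨Submodule.Quotient.mk y, rfl⟩
  refine he _ p (projectiveResolution _) (fun j g => hf' _ p t.unop.unop ?_ _ j g) ?_
  · intro x hx
    exact smul_id_quotient_eq_zero _ (by rwa [hm1] at hx)
  · exact huv.trans (map_zero _)

lemma HasDepth.depthM_eq {k : Type} [Field k] {σ : Type} {d : ℕ} {M : Type} [AddCommGroup M]
    [Module (MvPolynomial σ k) M] (h : HasDepth (maxHomIdeal k σ) d M) :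
    depthM k (ModuleCat.of (MvPolynomial σ k) M) = d := by
  refine le_antisymm (Nat.sInf_le h.localCohomology_nontrivial) ?_
  refine le_csInf ⟨d, h.localCohomology_nontrivial⟩ fun i hi => ?_
  by_contra hlt
  exact not_subsingleton_iff_nontrivial.mpr hi
    (h.localCohomology_subsingleton (by omega))

end LocalCohomology

section ExtMapZero

lemma extClass_naturality {C : Type*} [Category* C] [Abelian C] [HasExt C]
    {S T : ShortComplex C} (hS : S.ShortExact) (hT : T.ShortExact) (φ : S ⟶ T) :
    hS.extClass.comp (Ext.mk₀ φ.τ₁) (add_zero 1) =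
      (Ext.mk₀ φ.τ₃).comp hT.extClass (zero_add 1) := by
  let := HasDerivedCategory.standard C
  ext
  simp only [Ext.comp_hom, Ext.mk₀_hom, ShortComplex.ShortExact.extClass_hom,
    ShiftedHom.comp_mk₀, ShiftedHom.mk₀_comp]
  exact (ShortComplex.ShortExact.singleTriangle.map hS hT φ).comm₃

variable {R : Type} [CommRing R] {m : Ideal R}

/-- The linear map `φ` induces the zero map on `Ext^d(R/m, -)`. -/
def ExtMapZero (m : Ideal R) (d : ℕ) {M M' : Type} [AddCommGroup M] [Module R M]
    [AddCommGroup M'] [Module R M'] (φ : M →ₗ[R] M') : Prop :=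
  ∀ α : Ext (ModuleCat.of R (R ⧸ m)) (ModuleCat.of R M) d,
    α.comp (Ext.mk₀ (ModuleCat.ofHom φ)) (add_zero d) = 0

variable {M M' N N' : Type} [AddCommGroup M] [Module R M] [AddCommGroup M'] [Module R M']
  [AddCommGroup N] [Module R N] [AddCommGroup N'] [Module R N']

lemma ExtMapZero.comp {d : ℕ} {φ : M →ₗ[R] M'} (h : ExtMapZero m d φ) (f : N →ₗ[R] M)
    (g : M' →ₗ[R] N') : ExtMapZero m d (g ∘ₗ φ ∘ₗ f) := by
  intro α
  rw [ModuleCat.ofHom_comp, ModuleCat.ofHom_comp, Category.assoc, ← Ext.mk₀_comp_mk₀,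
    ← Ext.mk₀_comp_mk₀, ← Ext.comp_assoc_of_second_deg_zero, ← Ext.comp_assoc_of_second_deg_zero,
    h, Ext.zero_comp]

lemma extMapZero_zero {φ : M →ₗ[R] M'} (h : ∀ u, (∀ a ∈ m, a • u = 0) → φ u = 0) :
    ExtMapZero m 0 φ := by
  intro α
  obtain ⟨f, rfl⟩ := Ext.homEquiv₀.symm.surjective α
  rw [Ext.homEquiv₀_symm_apply, Ext.mk₀_comp_mk₀, Ext.mk₀_eq_zero_iff]
  ext
  refine h _ fun a ha => ?_
  have : a • (1 : R ⧸ m) = 0 := by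
    rw [Algebra.smul_def, mul_one]
    exact Ideal.Quotient.eq_zero_iff_mem.mpr ha
  change a • f.hom 1 = 0
  rw [← map_smul, this, map_zero]

lemma extMapZero_succ {d : ℕ} {φ : M →ₗ[R] M'} {x : R} (hx : x ∈ m) (hM : IsSMulRegular M x)
    (hM' : IsSMulRegular M' x) (h : ExtMapZero m d (QuotSMulTop.map x φ)) :
    ExtMapZero m (d + 1) φ := by
  intro α
  have hS : ((ModuleCat.of R M).smulShortComplex x).ShortExact :=
    IsSMulRegular.smulShortComplex_shortExact hM
  have hT : ((ModuleCat.of R M').smulShortComplex x).ShortExact :=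
    IsSMulRegular.smulShortComplex_shortExact hM'
  let ψ : (ModuleCat.of R M).smulShortComplex x ⟶ (ModuleCat.of R M').smulShortComplex x :=
    { τ₁ := ModuleCat.ofHom φ
      τ₂ := ModuleCat.ofHom φ
      τ₃ := ModuleCat.ofHom (QuotSMulTop.map x φ)
      comm₁₂ := by
        ext u
        exact (map_smul φ x u).symm
      comm₂₃ := by
        ext u
        rfl }
  obtain ⟨y, rfl⟩ := Ext.covariant_sequence_exact₁ _ hS α (ext_smul_eq_zero hx _ α)
    (n₀ := d) rfl
  change (y.comp hS.extClass rfl).comp (Ext.mk₀ ψ.τ₁) (add_zero (d + 1)) = 0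
  rw [Ext.comp_assoc_of_third_deg_zero, extClass_naturality hS hT ψ,
    ← Ext.comp_assoc_of_second_deg_zero]
  have : y.comp (Ext.mk₀ ψ.τ₃) (add_zero d) = 0 := h y
  rw [this, Ext.zero_comp]

end ExtMapZero

section Brodmann

variable {R : Type} [CommRing R]

/-- The filtration `𝔟 • F`. -/
def smulFiltration {I : Ideal R} {M : Type*} [AddCommGroup M] [Module R M] (𝔟 : Ideal R)
    (F : I.Filtration M) : I.Filtration M where
  N i := 𝔟 • F.N i
  mono i := Submodule.smul_mono le_rfl (F.mono i)
  smul_le i := by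
    rw [← mul_smul, mul_comm, mul_smul]
    exact Submodule.smul_mono le_rfl (F.smul_le i)

/-- The elements of the filtration `F` which are mapped into `𝔟 • F` by `m`. -/
def colonFiltration {I : Ideal R} {M : Type*} [AddCommGroup M] [Module R M] (𝔟 m : Ideal R)
    (F : I.Filtration M) : I.Filtration M where
  N i :=
    { carrier := {u | u ∈ F.N i ∧ ∀ a ∈ m, a • u ∈ 𝔟 • F.N i}
      add_mem' := fun hu hv =>
        ⟨add_mem hu.1 hv.1, fun a ha => by
          rw [smul_add]
          exact add_mem (hu.2 a ha) (hv.2 a ha)⟩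
      zero_mem' := ⟨zero_mem _, fun a _ => by
          rw [smul_zero]
          exact zero_mem _⟩
      smul_mem' := fun c u hu => ⟨Submodule.smul_mem _ _ hu.1, fun a ha => by
          rw [smul_comm]
          exact Submodule.smul_mem _ _ (hu.2 a ha)⟩ }
  mono i := fun u hu => ⟨F.mono i hu.1, fun a ha => (smulFiltration 𝔟 F).mono i (hu.2 a ha)⟩
  smul_le i := by
    refine Submodule.smul_le.mpr fun r hr u hu => ⟨F.smul_le i (Submodule.smul_mem_smul hr hu.1),
      fun a ha => ?_⟩
    rw [smul_comm]
    exact (smulFiltration 𝔟 F).smul_le i (Submodule.smul_mem_smul hr (hu.2 a ha))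

lemma exists_regular_or_exists_socle {S : Type} [CommRing S] [IsNoetherianRing S] (f : R →+* S)
    {P : Type} [AddCommGroup P] [Module S P] {N : Submodule S P} (hN : N.FG) (G : Submodule S P)
    (m : Ideal R) :
    (∃ x ∈ m, ∀ u ∈ N, f x • u ∈ G → u ∈ G) ∨ ∃ u ∈ N, u ∉ G ∧ ∀ a ∈ m, f a • u ∈ G := by
  have : Module.Finite S ↥N := Module.Finite.iff_fg.mpr hN
  let W := ↥N ⧸ G.comap N.subtype
  by_cases hx : ∃ x ∈ m, IsSMulRegular W (f x)
  · obtain ⟨x, hxm, hx⟩ := hx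
    refine .inl ⟨x, hxm, fun u hu hxu => ?_⟩
    have h1 := (isSMulRegular_iff_right_eq_zero_of_smul.mp hx)
      (Submodule.Quotient.mk ⟨u, hu⟩) (by
        rw [← Submodule.Quotient.mk_smul, Submodule.Quotient.mk_eq_zero]
        exact hxu)
    rwa [Submodule.Quotient.mk_eq_zero] at h1
  · push Not at hx
    have hsub : (m : Set R) ⊆ ⋃ P ∈ associatedPrimes S W, (P.comap f : Set R) := by
      intro x hxm
      have h2 : f x ∈ ⋃ P ∈ associatedPrimes S W, (P : Set S) := by
        rw [biUnion_associatedPrimes_eq_compl_regular]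
        exact hx x hxm
      simpa using h2
    have hfin := associatedPrimes.finite S W
    rw [Ideal.subset_union_prime_finite hfin ⊥ ⊥] at hsub
    · obtain ⟨P, hP, hmP⟩ := hsub
      replace hP : IsAssociatedPrime P W := hP
      obtain ⟨w, hw⟩ := (isAssociatedPrime_iff.mp hP).2
      obtain ⟨⟨u, hu⟩, rfl⟩ := Submodule.Quotient.mk_surjective _ w
      refine .inr ⟨u, hu, fun huG => hP.isPrime.ne_top (hw.trans ?_), fun a ha => ?_⟩
      · rw [Ideal.eq_top_iff_one, Submodule.mem_colon_singleton, one_smul, Submodule.mem_bot,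
          Submodule.Quotient.mk_eq_zero]
        exact huG
      · have h3 : f a ∈ P := hmP ha
        rwa [hw, Submodule.mem_colon_singleton, Submodule.mem_bot, ← Submodule.Quotient.mk_smul,
          Submodule.Quotient.mk_eq_zero] at h3
    · intro P hP _ _
      replace hP : IsAssociatedPrime P W := hP
      have := hP.isPrime
      exact Ideal.comap_isPrime _ _

lemma exists_regular_of_colonFiltration_le [IsNoetherianRing R] {I : Ideal R} {M : Type}
    [AddCommGroup M] [Module R M] [Module.Finite R M] {𝔟 m : Ideal R} {F : I.Filtration M}
    (hF : F.Stable) (h : ∀ i, (colonFiltration 𝔟 m F).N i ≤ 𝔟 • F.N i) :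
    ∃ x ∈ m, ∀ i, ∀ u ∈ F.N i, x • u ∈ 𝔟 • F.N i → u ∈ 𝔟 • F.N i := by
  let G := smulFiltration 𝔟 F
  have hfg : F.submodule.FG :=
    (F.submodule_fg_iff_stable fun i => IsNoetherian.noetherian _).mpr hF
  have hcoeff : ∀ (a : R) (f : PolynomialModule R M), algebraMap R (reesAlgebra I) a • f = a • f :=
    fun a f => algebraMap_smul _ _ _
  rcases exists_regular_or_exists_socle (algebraMap R (reesAlgebra I)) hfg G.submodule m with
    ⟨x, hxm, hx⟩ | ⟨f, hf, hfG, ha⟩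
  · refine ⟨x, hxm, fun i u hu hxu => ?_⟩
    have hs : ∀ (H : I.Filtration M) (v : M), PolynomialModule.single R i v ∈ H.submodule ↔
        v ∈ H.N i := by
      intro H v
      rw [Ideal.Filtration.mem_submodule]
      refine ⟨fun h => by simpa using h i, fun h j => ?_⟩
      rw [PolynomialModule.coeff_single, Finsupp.single_apply]
      split_ifs with hij
      · exact hij ▸ h
      · exact zero_mem _
    refine (hs G u).mp (hx _ ((hs F u).mpr hu) ?_)
    rw [hcoeff, ← PolynomialModule.single_smul]
    exact (hs G _).mpr hxu
  · refine (hfG ?_).elim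
    rw [Ideal.Filtration.mem_submodule]
    refine fun i => h i ⟨F.mem_submodule f |>.mp hf i, fun a ham => ?_⟩
    have h4 := ha a ham
    rw [hcoeff] at h4
    exact h4 i

/-- The quotient of `M ⧸ 𝔟M` by `x`. -/
noncomputable def quotSMulTopQuotEquiv (M : Type) [AddCommGroup M] [Module R M] (𝔟 : Ideal R)
    (x : R) :
    QuotSMulTop x (M ⧸ 𝔟 • (⊤ : Submodule R M)) ≃ₗ[R]
      M ⧸ (𝔟 ⊔ Ideal.span {x}) • (⊤ : Submodule R M) :=
  (Submodule.quotEquivOfEq _ _ (by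
    rw [Submodule.map_smul'', Submodule.map_top, Submodule.range_mkQ,
      Submodule.ideal_span_singleton_smul])).trans <|
    (Submodule.quotientQuotientEquivQuotientSup (𝔟 • (⊤ : Submodule R M))
      (Ideal.span {x} • (⊤ : Submodule R M))).trans
      (Submodule.quotEquivOfEq _ _ (Submodule.sup_smul _ _ _).symm)

lemma hasDepth_zero_quotient {M : Type} [AddCommGroup M] [Module R M] {m : Ideal R}
    {N : Submodule R M} {u : M} (hu : u ∉ N) (h : ∀ a ∈ m, a • u ∈ N) : HasDepth m 0 (M ⧸ N) := by
  refine ⟨Submodule.Quotient.mk u, by simpa using hu, fun a ha => ?_⟩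
  rw [← Submodule.Quotient.mk_smul, Submodule.Quotient.mk_eq_zero]
  exact h a ha

lemma isSMulRegular_quotient {M : Type} [AddCommGroup M] [Module R M] {x : R}
    {N : Submodule R M} (h : ∀ u, x • u ∈ N → u ∈ N) : IsSMulRegular (M ⧸ N) x := by
  refine isSMulRegular_iff_right_eq_zero_of_smul.mpr fun w hw => ?_
  obtain ⟨u, rfl⟩ := Submodule.Quotient.mk_surjective _ w
  rw [← Submodule.Quotient.mk_smul, Submodule.Quotient.mk_eq_zero] at hw
  exact (Submodule.Quotient.mk_eq_zero _).mpr (h u hw)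

/-- The map `M ⧸ 𝔟M → M' ⧸ 𝔟M'` induced by `φ`. -/
def quotMap (𝔟 : Ideal R) {M M' : Type} [AddCommGroup M] [Module R M] [AddCommGroup M']
    [Module R M'] (φ : M →ₗ[R] M') :
    (M ⧸ 𝔟 • (⊤ : Submodule R M)) →ₗ[R] M' ⧸ 𝔟 • (⊤ : Submodule R M') :=
  Submodule.mapQ _ _ φ (by
    rw [← Submodule.map_le_iff_le_comap, Submodule.map_smul'']
    exact Submodule.smul_mono le_rfl le_top)

lemma ExtMapZero.quotMap_succ {m 𝔟 : Ideal R} {d : ℕ} {M M' : Type} [AddCommGroup M] [Module R M]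
    [AddCommGroup M'] [Module R M'] {φ : M →ₗ[R] M'} {x : R} (hx : x ∈ m)
    (hM : IsSMulRegular (M ⧸ 𝔟 • (⊤ : Submodule R M)) x)
    (hM' : IsSMulRegular (M' ⧸ 𝔟 • (⊤ : Submodule R M')) x)
    (h : ExtMapZero m d (quotMap (𝔟 ⊔ Ideal.span {x}) φ)) :
    ExtMapZero m (d + 1) (quotMap 𝔟 φ) := by
  refine extMapZero_succ hx hM hM' ?_
  have h1 := h.comp (quotSMulTopQuotEquiv M 𝔟 x).toLinearMap
    (quotSMulTopQuotEquiv M' 𝔟 x).symm.toLinearMap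
  have h2 : QuotSMulTop.map x (quotMap 𝔟 φ) = (quotSMulTopQuotEquiv M' 𝔟 x).symm.toLinearMap ∘ₗ
      quotMap (𝔟 ⊔ Ideal.span {x}) φ ∘ₗ (quotSMulTopQuotEquiv M 𝔟 x).toLinearMap := by
    refine LinearMap.ext fun w => ?_
    rw [LinearMap.comp_apply, LinearEquiv.coe_coe, LinearEquiv.eq_symm_apply]
    obtain ⟨w, rfl⟩ := Submodule.Quotient.mk_surjective _ w
    obtain ⟨w, rfl⟩ := Submodule.Quotient.mk_surjective _ w
    rfl
  rwa [h2]

lemma exists_eventually_hasDepth [IsNoetherianRing R] {m : Ideal R} (M : ℕ → Type)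
    [∀ n, AddCommGroup (M n)] [∀ n, Module R (M n)] (φ : ∀ n, M (n + 1) →ₗ[R] M n)
    (hM : ∀ n, m • (⊤ : Submodule R (M n)) ≠ ⊤)
    (H : ∀ 𝔟 ≤ m, (∀ᶠ n in Filter.atTop, (∃ u, u ∉ 𝔟 • (⊤ : Submodule R (M n)) ∧
        ∀ a ∈ m, a • u ∈ 𝔟 • (⊤ : Submodule R (M n))) ∧
        ∀ u : M (n + 1), (∀ a ∈ m, a • u ∈ 𝔟 • (⊤ : Submodule R (M (n + 1)))) →
          φ n u ∈ 𝔟 • (⊤ : Submodule R (M n))) ∨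
      ∃ x ∈ m, ∀ᶠ n in Filter.atTop, ∀ u, x • u ∈ 𝔟 • (⊤ : Submodule R (M n)) →
        u ∈ 𝔟 • (⊤ : Submodule R (M n)))
    (𝔟 : Ideal R) (h𝔟 : 𝔟 ≤ m) :
    ∃ d, ∀ᶠ n in Filter.atTop, HasDepth m d (M n ⧸ 𝔟 • (⊤ : Submodule R (M n))) ∧
      ExtMapZero m d (quotMap 𝔟 (φ n)) := by
  induction 𝔟 using WellFoundedGT.induction with
  | ind 𝔟 ih =>
  rcases H 𝔟 h𝔟 with h | ⟨x, hx, h⟩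
  · refine ⟨0, h.mono fun n ⟨⟨u, hu, hu'⟩, hφ⟩ => ⟨hasDepth_zero_quotient hu hu',
      extMapZero_zero fun w hw => ?_⟩⟩
    obtain ⟨w, rfl⟩ := Submodule.Quotient.mk_surjective _ w
    refine (Submodule.Quotient.mk_eq_zero _).mpr (hφ w fun a ha => ?_)
    rw [← Submodule.Quotient.mk_eq_zero, Submodule.Quotient.mk_smul]
    exact hw a ha
  · have hx𝔟 : x ∉ 𝔟 := by
      intro hx𝔟
      obtain ⟨n, hn⟩ := h.exists
      refine hM n (top_le_iff.mp fun u _ => Submodule.smul_mono h𝔟 le_rfl (hn u ?_))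
      exact Submodule.smul_mem_smul hx𝔟 trivial
    have hle : Ideal.span {x} ≤ m := (Ideal.span_singleton_le_iff_mem _).mpr hx
    obtain ⟨d, hd⟩ := ih (𝔟 ⊔ Ideal.span {x}) (by
      refine lt_of_le_of_ne le_sup_left fun heq => hx𝔟 ?_
      rw [heq]
      exact (le_sup_right : Ideal.span {x} ≤ _) (Ideal.mem_span_singleton_self x))
      (sup_le h𝔟 hle)
    refine ⟨d + 1, ((h.and (Filter.tendsto_add_atTop_nat 1 |>.eventually h)).and hd).mono
      fun n ⟨⟨hn, hn'⟩, hdn, hφ⟩ => ⟨⟨x, hx, isSMulRegular_quotient hn, ?_⟩, ?_⟩⟩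
    · exact hdn.congr (quotSMulTopQuotEquiv (M n) 𝔟 x).symm
    · exact hφ.quotMap_succ hx (isSMulRegular_quotient hn') (isSMulRegular_quotient hn)

lemma exists_hasDepth [IsNoetherianRing R] {m : Ideal R} (M : Type) [AddCommGroup M]
    [Module R M] [Module.Finite R M] (hM : m • (⊤ : Submodule R M) ≠ ⊤) : ∃ d, HasDepth m d M := by
  obtain ⟨d, hd⟩ := exists_eventually_hasDepth (m := m) (fun _ => M) 0 (fun _ => hM) (fun 𝔟 _ => by
    rcases exists_regular_or_exists_socle (RingHom.id R) (N := (⊤ : Submodule R M))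
      Module.Finite.fg_top (𝔟 • (⊤ : Submodule R M)) m with ⟨x, hx, h⟩ | ⟨u, -, hu, h⟩
    · exact .inr ⟨x, hx, .of_forall fun _ u hu => h u trivial hu⟩
    · exact .inl (.of_forall fun _ => ⟨⟨u, hu, h⟩, fun _ _ => zero_mem _⟩)) ⊥ bot_le
  exact ⟨d, hd.exists.choose_spec.1.congr (Submodule.quotEquivOfEqBot _ (Submodule.bot_smul _))⟩

/-- The filtration `F` with indices shifted by `n`. -/
def shiftFiltration {I : Ideal R} {M : Type*} [AddCommGroup M] [Module R M] (F : I.Filtration M)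
    (n : ℕ) : I.Filtration M where
  N i := F.N (n + i)
  mono i := F.mono (n + i)
  smul_le i := F.smul_le (n + i)

lemma exists_eventually_hasDepth_filtration [IsNoetherianRing R] {m I : Ideal R} {M : Type}
    [AddCommGroup M] [Module R M] [Module.Finite R M] {F : I.Filtration M} (hF : F.Stable)
    (hm : ∀ n, m • F.N n ≠ F.N n) (hI : I ≤ m) (𝔟 : Ideal R) (h𝔟 : 𝔟 ≤ m) :
    ∃ d, ∀ᶠ n in Filter.atTop, HasDepth m d (F.N n ⧸ 𝔟 • (⊤ : Submodule R (F.N n))) ∧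
      ExtMapZero m d (quotMap 𝔟 (Submodule.inclusion (F.mono n))) := by
  refine exists_eventually_hasDepth (fun n => F.N n) _ (fun n h => hm n ?_) (fun 𝔟 h𝔟 => ?_) 𝔟 h𝔟
  · refine le_antisymm Submodule.smul_le_right fun u hu => ?_
    exact (Submodule.mem_smul_top_iff m (F.N n) ⟨u, hu⟩).mp (by rw [h]; trivial)
  · have hK : (colonFiltration 𝔟 m F).Stable := hF.of_le fun n u hu => hu.1
    obtain ⟨n₀, hn₀⟩ := hK
    by_cases h : ∃ n₁ ≥ n₀, (colonFiltration 𝔟 m F).N n₁ ≤ 𝔟 • F.N n₁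
    · obtain ⟨n₁, hn₁, h⟩ := h
      have hle : ∀ i, (colonFiltration 𝔟 m F).N (n₁ + i) ≤ 𝔟 • F.N (n₁ + i) := by
        intro i
        induction i with
        | zero => exact h
        | succ i ih =>
          rw [← add_assoc, ← hn₀ (n₁ + i) (by omega)]
          exact (Submodule.smul_mono le_rfl ih).trans ((smulFiltration 𝔟 F).smul_le (n₁ + i))
      have hF' : (shiftFiltration F n₁).Stable := by
        obtain ⟨n₂, hn₂⟩ := hF
        exact ⟨n₂, fun n hn => hn₂ (n₁ + n) (by omega)⟩
      obtain ⟨x, hx, hreg⟩ := exists_regular_of_colonFiltration_le hF' hle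
      refine .inr ⟨x, hx, Filter.eventually_atTop.mpr ⟨n₁, fun n hn u hu => ?_⟩⟩
      obtain ⟨i, rfl⟩ := Nat.exists_eq_add_of_le hn
      rw [Submodule.mem_smul_top_iff] at hu ⊢
      exact hreg i u u.2 hu
    · push Not at h
      refine .inl (Filter.eventually_atTop.mpr ⟨n₀, fun n hn => ?_⟩)
      obtain ⟨u, hu, hu'⟩ := SetLike.not_le_iff_exists.mp (h n hn)
      refine ⟨⟨⟨u, hu.1⟩, ?_, fun a ha => ?_⟩, fun v hv => ?_⟩
      · rwa [Submodule.mem_smul_top_iff]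
      · rw [Submodule.mem_smul_top_iff]
        exact hu.2 a ha
      · have hv' : (v : M) ∈ (colonFiltration 𝔟 m F).N (n + 1) :=
          ⟨v.2, fun a ha => (Submodule.mem_smul_top_iff _ _ (a • v)).mp (hv a ha)⟩
        rw [← hn₀ n hn] at hv'
        rw [Submodule.mem_smul_top_iff]
        refine Submodule.smul_le.mpr (fun r hr w hw => ?_) hv'
        exact hw.2 r (hI hr)

lemma smul_ne_self_of_fg {M : Type} [AddCommGroup M] [Module R M] [IsDomain R]
    [Module.IsTorsionFree R M] {m : Ideal R} (hm : m ≠ ⊤) {N : Submodule R M} (hN : N.FG)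
    (h0 : N ≠ ⊥) : m • N ≠ N := by
  intro h
  obtain ⟨r, hr, hr'⟩ :=
    Submodule.exists_sub_one_mem_and_smul_eq_zero_of_fg_of_le_smul m N hN h.ge
  obtain ⟨u, hu, hu0⟩ := Submodule.exists_mem_ne_zero_of_ne_bot h0
  have : r = 0 := (smul_eq_zero.mp (hr' u hu)).resolve_right hu0
  subst this
  refine hm ((Ideal.eq_top_iff_one _).mpr ?_)
  simpa using hr

lemma exists_eventually_hasDepth_pow [IsNoetherianRing R] [IsDomain R] {m I : Ideal R}
    (hm : m ≠ ⊤) (hI : I ≠ ⊥) (hIm : I ≤ m) :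
    ∃ d, ∀ᶠ n in Filter.atTop, HasDepth m d ↥(I ^ n) ∧
      ExtMapZero m d (Submodule.inclusion (Ideal.pow_le_pow_right (I := I) n.le_succ)) := by
  let F : I.Filtration R :=
    { N := fun n => I ^ n
      mono := fun n => Ideal.pow_le_pow_right n.le_succ
      smul_le := fun n => (pow_succ' I n).ge }
  obtain ⟨d, hd⟩ := exists_eventually_hasDepth_filtration (m := m) (F := F)
    ⟨0, fun n _ => (pow_succ' I n).symm⟩
    (fun n => smul_ne_self_of_fg hm (IsNoetherian.noetherian _) (pow_ne_zero n hI)) hIm ⊥ bot_le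
  have e : ∀ n, (⊥ : Ideal R) • (⊤ : Submodule R ↥(I ^ n)) = ⊥ := fun n => Submodule.bot_smul _
  refine ⟨d, hd.mono fun n ⟨hn, hφ⟩ => ⟨hn.congr (Submodule.quotEquivOfEqBot _ (e n)), ?_⟩⟩
  exact hφ.comp (Submodule.quotEquivOfEqBot _ (e _)).symm.toLinearMap
    (Submodule.quotEquivOfEqBot _ (e n)).toLinearMap

end Brodmann

section PolynomialRing

lemma HasDepth.le_supportDim {R : Type} [CommRing R] [IsNoetherianRing R] {m : Ideal R} {d : ℕ}
    {M : Type} [AddCommGroup M] [Module R M] [Module.Finite R M] (h : HasDepth m d M) :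
    (d : WithBot ℕ∞) ≤ Module.supportDim R M := by
  induction d generalizing M with
  | zero =>
    have := h.nontrivial
    have h0 := Module.supportDim_ne_bot_of_nontrivial R M
    obtain ⟨n, hn⟩ := WithBot.ne_bot_iff_exists.mp h0
    rw [← hn]
    exact_mod_cast zero_le
  | succ d ih =>
    obtain ⟨x, hx, hr, h⟩ := h
    refine le_trans ?_ (Module.supportDim_quotSMulTop_succ_le_of_notMem_minimalPrimes
      (fun _ => hr.notMem_of_mem_minimalPrimes))
    push_cast
    gcongr
    exact ih h

variable {k : Type} [Field k] {σ : Type}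

lemma HasDepth.le_card [Finite σ] {m : Ideal (MvPolynomial σ k)} {d : ℕ} {M : Type}
    [AddCommGroup M] [Module (MvPolynomial σ k) M] [Module.Finite (MvPolynomial σ k) M]
    (h : HasDepth m d M) : d ≤ Nat.card σ := by
  have h1 := h.le_supportDim.trans (Module.supportDim_le_ringKrullDim _ _)
  rw [MvPolynomial.ringKrullDim_of_isNoetherianRing, ringKrullDim_eq_zero_of_field, zero_add] at h1
  exact_mod_cast h1

lemma mem_span_X_image_of_X_mul_mem {s : Set σ} {j : σ} (hj : j ∉ s) {p : MvPolynomial σ k}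
    (h : X j * p ∈ Ideal.span (X '' s : Set (MvPolynomial σ k))) :
    p ∈ Ideal.span (X '' s : Set (MvPolynomial σ k)) := by
  classical
  rw [mem_ideal_span_X_image] at h ⊢
  intro e he
  obtain ⟨i, hi, hie⟩ := h (Finsupp.single j 1 + e) (by
    rw [support_X_mul]
    exact Finset.mem_map_of_mem _ he)
  refine ⟨i, hi, ?_⟩
  rwa [Finsupp.add_apply, Finsupp.single_eq_of_ne (by rintro rfl; exact hj hi), zero_add] at hie

lemma one_notMem_span_X_image (s : Set σ) :
    (1 : MvPolynomial σ k) ∉ Ideal.span (X '' s : Set (MvPolynomial σ k)) := by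
  rw [mem_ideal_span_X_image]
  intro h
  obtain ⟨i, -, hi⟩ := h 0 (by simp)
  exact hi rfl

lemma maxHomIdeal_eq (k : Type) [Field k] (σ : Type) :
    maxHomIdeal k σ = Ideal.span (X '' Set.univ) := by
  rw [Set.image_univ]; rfl

lemma maxHomIdeal_ne_top (k : Type) [Field k] (σ : Type) : maxHomIdeal k σ ≠ ⊤ := by
  rw [Ideal.ne_top_iff_one, maxHomIdeal_eq]
  exact one_notMem_span_X_image _

lemma hasDepth_quotient_span_X [Finite σ] (n : ℕ) (s : Set σ) (hs : sᶜ.ncard = n) :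
    HasDepth (maxHomIdeal k σ) n (MvPolynomial σ k ⧸
      Ideal.span (X '' s : Set (MvPolynomial σ k)) • (⊤ : Ideal (MvPolynomial σ k))) := by
  induction n generalizing s with
  | zero =>
    have : s = Set.univ := by
      rw [Set.ncard_eq_zero] at hs
      simpa using hs
    subst this
    refine hasDepth_zero_quotient (u := 1) ?_ fun a ha => ?_
    · rw [smul_eq_mul, Ideal.mul_top]
      exact one_notMem_span_X_image _
    · rw [smul_eq_mul, Ideal.mul_top, smul_eq_mul, mul_one, ← maxHomIdeal_eq]
      exact ha
  | succ n ih =>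
    obtain ⟨j, hj⟩ : sᶜ.Nonempty := by
      rw [← Set.ncard_pos]
      omega
    refine ⟨X j, Ideal.subset_span ⟨j, rfl⟩, isSMulRegular_quotient fun u hu => ?_, ?_⟩
    · rw [smul_eq_mul, Ideal.mul_top] at hu ⊢
      exact mem_span_X_image_of_X_mul_mem hj hu
    · have h := ih (insert j s) (by
        have h1 : (insert j s)ᶜ = sᶜ \ {j} := by
          ext; simp [and_comm]
        rw [h1, Set.ncard_sdiff_singleton_of_mem hj, hs]
        rfl)
      rw [Set.image_insert_eq, Ideal.span_insert, sup_comm] at h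
      exact h.congr (quotSMulTopQuotEquiv _ _ _).symm

lemma hasDepth_mvPolynomial [Finite σ] :
    HasDepth (maxHomIdeal k σ) (Nat.card σ) (MvPolynomial σ k) := by
  refine (hasDepth_quotient_span_X (Nat.card σ) (∅ : Set σ) (by simp)).congr
    (Submodule.quotEquivOfEqBot _ ?_)
  simp

end PolynomialRing

section ExtVanish

variable {R : Type} [CommRing R] {m : Ideal R} {M N P : Type} [AddCommGroup M] [Module R M]
  [AddCommGroup N] [Module R N] [AddCommGroup P] [Module R P]

/-- The modules `Ext^i(R/m, M)` vanish for `i < t`. -/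
def ExtVanish (m : Ideal R) (M : Type) [AddCommGroup M] [Module R M] (t : ℕ) : Prop :=
  ∀ i < t, Subsingleton (Ext (ModuleCat.of R (R ⧸ m)) (ModuleCat.of R M) i)

lemma ExtVanish.mono {s t : ℕ} (h : ExtVanish m M t) (hst : s ≤ t) : ExtVanish m M s :=
  fun i hi => h i (hi.trans_le hst)

lemma HasDepth.extVanish_iff {d t : ℕ} (h : HasDepth m d M) : ExtVanish m M t ↔ t ≤ d := by
  refine ⟨fun ht => ?_, fun ht => ExtVanish.mono h.extDepth.1 ht⟩
  by_contra! hlt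
  exact not_subsingleton_iff_nontrivial.mpr h.extDepth.2 (ht d hlt)

lemma hasDepth_of_extVanish [IsNoetherianRing R] [Module.Finite R M] {d : ℕ}
    (hM : m • (⊤ : Submodule R M) ≠ ⊤) (h : ExtVanish m M d)
    (h' : Nontrivial (Ext (ModuleCat.of R (R ⧸ m)) (ModuleCat.of R M) d)) : HasDepth m d M := by
  obtain ⟨e, he⟩ := exists_hasDepth M hM
  rwa [ExtDepth.unique (M := ModuleCat.of R M) ⟨h, h'⟩ he.extDepth]

/-- The short complex attached to two composable linear maps with vanishing composition. -/
def linearShortComplex (f : M →ₗ[R] N) (g : N →ₗ[R] P) (h : Function.Exact f g) :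
    ShortComplex (ModuleCat.{0} R) :=
  ShortComplex.mk (ModuleCat.ofHom f) (ModuleCat.ofHom g) (by
    ext x
    exact h.apply_apply_eq_zero x)

variable {f : M →ₗ[R] N} {g : N →ₗ[R] P}

lemma linearShortComplex_shortExact (h : Function.Exact f g) (hf : Function.Injective f)
    (hg : Function.Surjective g) : (linearShortComplex f g h).ShortExact :=
  ModuleCat.shortComplex_shortExact _ h hf hg

lemma subsingleton_ext_mid (h : Function.Exact f g) (hf : Function.Injective f)
    (hg : Function.Surjective g) {X : ModuleCat.{0} R} {i : ℕ}
    (hM : Subsingleton (Ext X (ModuleCat.of R M) i))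
    (hP : Subsingleton (Ext X (ModuleCat.of R P) i)) :
    Subsingleton (Ext X (ModuleCat.of R N) i) := by
  have hS := linearShortComplex_shortExact h hf hg
  refine subsingleton_of_forall_eq 0 fun x => ?_
  obtain ⟨y, rfl⟩ := Ext.covariant_sequence_exact₂ X hS x (hP.elim _ _)
  rw [show y = 0 from hM.elim _ _, Ext.zero_comp]
  rfl

lemma subsingleton_ext_right (h : Function.Exact f g) (hf : Function.Injective f)
    (hg : Function.Surjective g) {X : ModuleCat.{0} R} {i : ℕ}
    (hN : Subsingleton (Ext X (ModuleCat.of R N) i))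
    (hM : Subsingleton (Ext X (ModuleCat.of R M) (i + 1))) :
    Subsingleton (Ext X (ModuleCat.of R P) i) := by
  have hS := linearShortComplex_shortExact h hf hg
  refine subsingleton_of_forall_eq 0 fun x => ?_
  obtain ⟨y, rfl⟩ := Ext.covariant_sequence_exact₃ X hS x rfl (hM.elim _ _)
  rw [show y = 0 from hN.elim _ _, Ext.zero_comp]
  rfl

lemma subsingleton_ext_left (h : Function.Exact f g) (hf : Function.Injective f)
    (hg : Function.Surjective g) {X : ModuleCat.{0} R} {i : ℕ}
    (hN : Subsingleton (Ext X (ModuleCat.of R N) (i + 1)))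
    (hP : Subsingleton (Ext X (ModuleCat.of R P) i)) :
    Subsingleton (Ext X (ModuleCat.of R M) (i + 1)) := by
  have hS := linearShortComplex_shortExact h hf hg
  refine subsingleton_of_forall_eq 0 fun x => ?_
  obtain ⟨y, rfl⟩ := Ext.covariant_sequence_exact₁ X hS x (hN.elim _ _) rfl
  rw [show y = 0 from hP.elim _ _, Ext.zero_comp]
  rfl

lemma subsingleton_ext_left_zero (h : Function.Exact f g) (hf : Function.Injective f)
    (hg : Function.Surjective g) {X : ModuleCat.{0} R}
    (hN : Subsingleton (Ext X (ModuleCat.of R N) 0)) :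
    Subsingleton (Ext X (ModuleCat.of R M) 0) := by
  have hS := linearShortComplex_shortExact h hf hg
  have := hS.mono_f
  have : Subsingleton (Ext X (linearShortComplex f g h).X₂ 0) := hN
  exact (Ext.postcomp_mk₀_injective_of_mono X (linearShortComplex f g h).f).subsingleton

lemma ExtVanish.mid (h : Function.Exact f g) (hf : Function.Injective f)
    (hg : Function.Surjective g) {t : ℕ} (hM : ExtVanish m M t) (hP : ExtVanish m P t) :
    ExtVanish m N t :=
  fun i hi => subsingleton_ext_mid h hf hg (hM i hi) (hP i hi)

lemma ExtVanish.left (h : Function.Exact f g) (hf : Function.Injective f)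
    (hg : Function.Surjective g) {t : ℕ} (hN : ExtVanish m N t) (hP : ExtVanish m P t) :
    ExtVanish m M t := by
  rintro (_ | i) hi
  · exact subsingleton_ext_left_zero h hf hg (hN 0 hi)
  · exact subsingleton_ext_left h hf hg (hN _ hi) (hP i (by omega))

lemma ExtVanish.right (h : Function.Exact f g) (hf : Function.Injective f)
    (hg : Function.Surjective g) {t : ℕ} (hN : ExtVanish m N t) (hM : ExtVanish m M (t + 1)) :
    ExtVanish m P t :=
  fun i hi => subsingleton_ext_right h hf hg (hN i hi) (hM _ (by omega))

lemma ExtMapZero.nontrivial_ext (h : Function.Exact f g) (hf : Function.Injective f)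
    (hg : Function.Surjective g) {d : ℕ} (hz : ExtMapZero m (d + 1) f)
    (hM : Nontrivial (Ext (ModuleCat.of R (R ⧸ m)) (ModuleCat.of R M) (d + 1))) :
    Nontrivial (Ext (ModuleCat.of R (R ⧸ m)) (ModuleCat.of R P) d) := by
  have hS := linearShortComplex_shortExact h hf hg
  obtain ⟨x, hx⟩ := exists_ne (0 : Ext (ModuleCat.of R (R ⧸ m)) (ModuleCat.of R M) (d + 1))
  obtain ⟨y, rfl⟩ := Ext.covariant_sequence_exact₁ _ hS x (hz x) (n₀ := d) rfl
  refine nontrivial_of_ne y (0 : Ext _ (linearShortComplex f g h).X₃ d) fun hy => hx ?_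
  rw [hy, Ext.zero_comp]
  rfl

end ExtVanish

section Powers

variable {R : Type} [CommRing R]

/-- The subquotient `p/q`. -/
abbrev SubQuotient (p q : Ideal R) : Type := ↥p ⧸ Submodule.comap p.subtype q

lemma exact_inclusion_mkQ {p q : Ideal R} (h : q ≤ p) :
    Function.Exact (Submodule.inclusion h) (Submodule.comap p.subtype q).mkQ := by
  intro x
  rw [Submodule.mkQ_apply, Submodule.Quotient.mk_eq_zero]
  exact ⟨fun hx => ⟨⟨x, hx⟩, rfl⟩, by rintro ⟨y, rfl⟩; exact y.2⟩

lemma exact_subtype_mkQ (q : Ideal R) : Function.Exact q.subtype (Submodule.mkQ q) :=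
  LinearMap.exact_subtype_mkQ q

/-- The inclusion `p/q → R/q`. -/
def subQuotientInclusion (p q : Ideal R) : SubQuotient p q →ₗ[R] R ⧸ q :=
  Submodule.mapQ _ _ p.subtype le_rfl

lemma subQuotientInclusion_injective (p q : Ideal R) :
    Function.Injective (subQuotientInclusion p q) := by
  rw [injective_iff_map_eq_zero]
  intro x hx
  obtain ⟨x, rfl⟩ := Submodule.Quotient.mk_surjective _ x
  rw [Submodule.Quotient.mk_eq_zero]
  exact (Submodule.Quotient.mk_eq_zero q).mp hx

lemma exact_subQuotientInclusion {p q : Ideal R} (h : q ≤ p) :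
    Function.Exact (subQuotientInclusion p q) (Submodule.factor h) := by
  intro x
  obtain ⟨x, rfl⟩ := Submodule.Quotient.mk_surjective _ x
  refine ⟨fun hx => ⟨Submodule.Quotient.mk ⟨x, (Submodule.Quotient.mk_eq_zero p).mp hx⟩, rfl⟩, ?_⟩
  rintro ⟨y, hy⟩
  obtain ⟨y, rfl⟩ := Submodule.Quotient.mk_surjective _ y
  rw [← hy]
  exact (Submodule.Quotient.mk_eq_zero p).mpr y.2

lemma smul_top_subQuotient_ne_top {m p q : Ideal R} (hq : q ≤ m * p) (hp : m * p ≠ p) :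
    m • (⊤ : Submodule R (SubQuotient p q)) ≠ ⊤ := by
  intro h
  have h1 : m • (⊤ : Submodule R ↥p) ⊔ Submodule.comap p.subtype q = ⊤ := by
    rw [sup_comm, ← Submodule.map_mkQ_eq_top, Submodule.map_smul'', Submodule.map_top, Submodule.range_mkQ]
    exact h
  refine hp (le_antisymm Ideal.mul_le_right fun x hx => ?_)
  have h2 : (⟨x, hx⟩ : p) ∈ m • (⊤ : Submodule R ↥p) ⊔ Submodule.comap p.subtype q := by
    rw [h1]; trivial
  have h3 : Submodule.comap p.subtype q ≤ m • (⊤ : Submodule R ↥p) := fun y hy =>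
    (Submodule.mem_smul_top_iff m p y).mpr (hq hy)
  rw [sup_eq_left.mpr h3] at h2
  exact (Submodule.mem_smul_top_iff m p _).mp h2

lemma smul_top_quotient_ne_top {m q : Ideal R} (hq : q ≤ m) (hm : m ≠ ⊤) :
    m • (⊤ : Submodule R (R ⧸ q)) ≠ ⊤ := by
  intro h
  have h1 : m • (⊤ : Submodule R R) ⊔ q = ⊤ := by
    rw [sup_comm, ← Submodule.map_mkQ_eq_top, Submodule.map_smul'', Submodule.map_top, Submodule.range_mkQ]
    exact h
  rw [smul_eq_mul, Ideal.mul_top, sup_eq_left.mpr hq] at h1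
  exact hm h1

lemma extVanish_quotient_pow_iff {m Q : Ideal R} {t : ℕ} :
    (∀ n, n ≠ 0 → ExtVanish m (R ⧸ Q ^ n) t) ↔
      ∀ n, ExtVanish m (SubQuotient (Q ^ n) (Q ^ (n + 1))) t := by
  have h0 : ExtVanish m (R ⧸ Q ^ 0) t := fun i _ => by
    have : Subsingleton (R ⧸ Q ^ 0) := Submodule.Quotient.subsingleton_iff.mpr (by simp)
    refine subsingleton_of_forall_eq 0 fun x => ?_
    rw [← Ext.comp_mk₀_id x, (ModuleCat.isZero_of_subsingleton (ModuleCat.of R (R ⧸ Q ^ 0))).eq_of_src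
      (𝟙 _) 0, Ext.mk₀_zero, Ext.comp_zero]
  constructor
  · intro h n
    have h' : ExtVanish m (R ⧸ Q ^ n) t := by
      rcases eq_or_ne n 0 with rfl | hn
      exacts [h0, h n hn]
    exact ExtVanish.left (exact_subQuotientInclusion (Ideal.pow_le_pow_right n.le_succ))
      (subQuotientInclusion_injective _ _) (Submodule.factor_surjective _)
      (h (n + 1) n.succ_ne_zero) h'
  · intro h n _
    induction n with
    | zero => exact h0
    | succ n ih =>
      have hle : Q ^ (n + 1) ≤ Q ^ n := Ideal.pow_le_pow_right n.le_succ
      have h' : ExtVanish m (R ⧸ Q ^ n) t := by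
        rcases eq_or_ne n 0 with rfl | hn
        exacts [h0, ih hn]
      exact ExtVanish.mid (exact_subQuotientInclusion hle)
        (subQuotientInclusion_injective _ _) (Submodule.factor_surjective hle) (h n) h'

variable [IsNoetherianRing R]

lemma exists_hasDepth_quotient_pow {m Q : Ideal R} (hm : m ≠ ⊤) (hQm : Q ≤ m)
    {n : ℕ} (hn : n ≠ 0) : ∃ d, HasDepth m d (R ⧸ Q ^ n) :=
  exists_hasDepth _ (smul_top_quotient_ne_top ((Ideal.pow_le_self hn).trans hQm) hm)

variable [IsDomain R]

lemma smul_top_subQuotient_pow_ne_top {m Q : Ideal R} (hm : m ≠ ⊤) (hQ : Q ≠ ⊥) (hQm : Q ≤ m)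
    (n : ℕ) : m • (⊤ : Submodule R (SubQuotient (Q ^ n) (Q ^ (n + 1)))) ≠ ⊤ := by
  refine smul_top_subQuotient_ne_top ?_ ?_
  · rw [pow_succ']
    exact Ideal.mul_mono_left hQm
  · exact smul_ne_self_of_fg hm (IsNoetherian.noetherian _) (pow_ne_zero n hQ)

lemma exists_hasDepth_subQuotient_pow {m Q : Ideal R} (hm : m ≠ ⊤) (hQ : Q ≠ ⊥) (hQm : Q ≤ m)
    (n : ℕ) : ∃ d, HasDepth m d (SubQuotient (Q ^ n) (Q ^ (n + 1))) := by
  exact exists_hasDepth _ (smul_top_subQuotient_pow_ne_top hm hQ hQm n)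

lemma exists_eventually_hasDepth_quotient_pow {m Q : Ideal R} (hm : m ≠ ⊤) (hQ : Q ≠ ⊥)
    (hQm : Q ≤ m) {D : ℕ} (hD : HasDepth m D R)
    (hle : ∀ (p : Ideal R) (d : ℕ), HasDepth m d p → d ≤ D) :
    ∃ e, ∀ᶠ n in Filter.atTop, HasDepth m e (R ⧸ Q ^ n) ∧
      HasDepth m e (SubQuotient (Q ^ n) (Q ^ (n + 1))) := by
  obtain ⟨d, hd⟩ := exists_eventually_hasDepth_pow hm hQ hQm
  obtain ⟨e, rfl⟩ : ∃ e, d = e + 1 := by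
    refine Nat.exists_eq_succ_of_ne_zero ?_
    rintro rfl
    obtain ⟨n, ⟨s, hs, hms⟩, -⟩ := hd.exists
    obtain ⟨a, ha, ha0⟩ := Submodule.exists_mem_ne_zero_of_ne_bot hQ
    have := congrArg Subtype.val (hms a (hQm ha))
    rcases mul_eq_zero.mp this with h | h
    exacts [ha0 h, hs (Subtype.ext h)]
  obtain ⟨N, hN⟩ := Filter.eventually_atTop.mp hd
  refine ⟨e, Filter.eventually_atTop.mpr ⟨N + 1, fun n hn => ?_⟩⟩
  constructor
  · obtain ⟨n, rfl⟩ : ∃ k, n = k + 1 := ⟨n - 1, by omega⟩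
    obtain ⟨h1, hz⟩ := hN n (by omega)
    obtain ⟨h2, -⟩ := hN (n + 1) (by omega)
    refine hasDepth_of_extVanish
      (smul_top_quotient_ne_top ((Ideal.pow_le_self n.succ_ne_zero).trans hQm) hm)
      (ExtVanish.right (exact_subtype_mkQ _) (Submodule.subtype_injective _)
        (Submodule.mkQ_surjective _)
        (hD.extVanish_iff.mpr (by have := hle _ _ h1; omega)) (h2.extVanish_iff.mpr le_rfl)) ?_
    exact ExtMapZero.nontrivial_ext (exact_subtype_mkQ _) (Submodule.subtype_injective _)
        (Submodule.mkQ_surjective _) (hz.comp LinearMap.id (Q ^ n).subtype) h2.extDepth.2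
  · obtain ⟨h1, hz⟩ := hN n (by omega)
    obtain ⟨h2, -⟩ := hN (n + 1) (by omega)
    have hle' : Q ^ (n + 1) ≤ Q ^ n := Ideal.pow_le_pow_right n.le_succ
    refine hasDepth_of_extVanish (smul_top_subQuotient_pow_ne_top hm hQ hQm n)
      (ExtVanish.right (exact_inclusion_mkQ hle') (Submodule.inclusion_injective _)
        (Submodule.mkQ_surjective _)
        (h1.extVanish_iff.mpr e.le_succ) (h2.extVanish_iff.mpr le_rfl)) ?_
    · exact ExtMapZero.nontrivial_ext (exact_inclusion_mkQ hle') (Submodule.inclusion_injective _)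
        (Submodule.mkQ_surjective _) hz h2.extDepth.2

end Powers

section OuterTensor

open TensorProduct

set_option linter.unusedSectionVars false

variable {k A B R : Type} [Field k] [CommRing A] [CommRing B] [CommRing R] [Algebra k A]
  [Algebra k B] [Algebra k R]
  {M N T : Type} [AddCommGroup M] [AddCommGroup N] [AddCommGroup T] [Module k M] [Module k N]
  [Module k T] [Module A M] [Module B N] [Module R T] [IsScalarTower k A M]
  [IsScalarTower k B N] [IsScalarTower k R T]

/-- The bilinear map `f` presents the `R`-module `T` as the tensor product over `k` of the
`A`-module `M` and the `B`-module `N`, where `R` acts through `ιA` and `ιB`. -/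
structure IsOuterTensor (ιA : A →ₐ[k] R) (ιB : B →ₐ[k] R) (f : M →ₗ[k] N →ₗ[k] T) : Prop where
  isTensorProduct : IsTensorProduct f
  map_smul_left : ∀ a x y, f (a • x) y = ιA a • f x y
  map_smul_right : ∀ b x y, f x (b • y) = ιB b • f x y

variable {ιA : A →ₐ[k] R} {ιB : B →ₐ[k] R} {f : M →ₗ[k] N →ₗ[k] T}

namespace IsOuterTensor

lemma flip (h : IsOuterTensor ιA ιB f) : IsOuterTensor ιB ιA f.flip where
  isTensorProduct := by
    have : TensorProduct.lift f.flip =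
        TensorProduct.lift f ∘ₗ (TensorProduct.comm k N M).toLinearMap := by
      ext; simp
    rw [IsTensorProduct, this, LinearMap.coe_comp]
    exact h.isTensorProduct.comp (TensorProduct.comm k N M).bijective
  map_smul_left b y x := h.map_smul_right b x y
  map_smul_right a y x := h.map_smul_left a x y

lemma lift_rTensor_lsmul (h : IsOuterTensor ιA ιB f) (x : A) (z : M ⊗[k] N) :
    TensorProduct.lift f (LinearMap.rTensor N (Algebra.lsmul k k M x) z) =
      ιA x • TensorProduct.lift f z := by
  induction z with
  | zero => simp
  | tmul a b => simp [h.map_smul_left]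
  | add a b ha hb => simp only [map_add, smul_add, ha, hb]

lemma isSMulRegular (h : IsOuterTensor ιA ιB f) {x : A} (hx : IsSMulRegular M x) :
    IsSMulRegular T (ιA x) := by
  have hinj : Function.Injective (LinearMap.rTensor N (Algebra.lsmul k k M x)) :=
    Module.Flat.rTensor_preserves_injective_linearMap _ hx
  intro s t hst
  obtain ⟨s, rfl⟩ := h.isTensorProduct.2 s
  obtain ⟨t, rfl⟩ := h.isTensorProduct.2 t
  simp only [← h.lift_rTensor_lsmul] at hst
  rw [hinj (h.isTensorProduct.1 hst)]

/-- The quotient map `M → M/xM` as a `k`-linear map. -/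
def quotMk (k : Type) [Field k] {A M : Type} [CommRing A] [Algebra k A] [AddCommGroup M]
    [Module k M] [Module A M] [IsScalarTower k A M] (x : A) : M →ₗ[k] QuotSMulTop x M :=
  (Submodule.mkQ (x • (⊤ : Submodule A M))).restrictScalars k

lemma quotMk_surjective (x : A) : Function.Surjective (quotMk k (M := M) x) :=
  Submodule.mkQ_surjective (x • (⊤ : Submodule A M))

lemma quotMk_comp_lsmul (x : A) : quotMk k (M := M) x ∘ₗ (Algebra.lsmul k k M x : M →ₗ[k] M) = 0 := by
  ext m
  exact (Submodule.Quotient.mk_eq_zero _).mpr (Submodule.smul_mem_pointwise_smul _ _ _ trivial)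

/-- The bilinear map presenting `T/xT` as an outer tensor product of `M/xM` and `N`. -/
noncomputable def quotMap (h : IsOuterTensor ιA ιB f) (x : A) :
    QuotSMulTop x M →ₗ[k] N →ₗ[k] QuotSMulTop (ιA x) T :=
  (Submodule.liftQ ((x • (⊤ : Submodule A M)).restrictScalars k)
    (f.compr₂ (quotMk k (M := T) (ιA x))) (by
      intro m hm
      obtain ⟨m, -, rfl⟩ := hm
      ext n
      simp only [LinearMap.compr₂_apply]
      erw [h.map_smul_left, Submodule.Quotient.mk_eq_zero]
      exact Submodule.smul_mem_pointwise_smul _ _ _ trivial)) ∘ₗ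
    (Submodule.Quotient.restrictScalarsEquiv k (x • (⊤ : Submodule A M))).symm.toLinearMap

lemma quotMap_mk (h : IsOuterTensor ιA ιB f) (x : A) (m : M) (n : N) :
    h.quotMap x (Submodule.Quotient.mk m) n = Submodule.Quotient.mk (f m n) := rfl

lemma quot (h : IsOuterTensor ιA ιB f) (x : A) : IsOuterTensor ιA ιB (h.quotMap x) where
  isTensorProduct := by
    have key : TensorProduct.lift (h.quotMap x) ∘ₗ
        LinearMap.rTensor N (quotMk k (M := M) x) =
        quotMk k (M := T) (ιA x) ∘ₗ
          TensorProduct.lift f := by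
      ext m n
      rfl
    have hsurj : Function.Surjective
        (LinearMap.rTensor N (quotMk k (M := M) x)) :=
      LinearMap.rTensor_surjective _ (quotMk_surjective (M := M) x)
    constructor
    · rw [← LinearMap.ker_eq_bot, LinearMap.ker_eq_bot']
      intro z hz
      obtain ⟨z, rfl⟩ := hsurj z
      have h1 := LinearMap.congr_fun key z
      rw [LinearMap.comp_apply, hz] at h1
      obtain ⟨t, -, ht⟩ := (Submodule.Quotient.mk_eq_zero _).mp h1.symm
      obtain ⟨w, rfl⟩ := h.isTensorProduct.2 t
      have h3 : z = LinearMap.rTensor N (Algebra.lsmul k k M x) w :=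
        h.isTensorProduct.1 (by rw [h.lift_rTensor_lsmul]; exact ht.symm)
      rw [h3, ← LinearMap.comp_apply, ← LinearMap.rTensor_comp]
      rw [quotMk_comp_lsmul, LinearMap.rTensor_zero, LinearMap.zero_apply]
    · intro t
      obtain ⟨t, rfl⟩ := Submodule.Quotient.mk_surjective _ t
      obtain ⟨z, rfl⟩ := h.isTensorProduct.2 t
      exact ⟨_, LinearMap.congr_fun key z⟩
  map_smul_left a m n := by
    obtain ⟨m, rfl⟩ := Submodule.Quotient.mk_surjective _ m
    rw [← Submodule.Quotient.mk_smul, quotMap_mk, quotMap_mk, h.map_smul_left]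
    rfl
  map_smul_right b m n := by
    obtain ⟨m, rfl⟩ := Submodule.Quotient.mk_surjective _ m
    rw [quotMap_mk, quotMap_mk, h.map_smul_right]
    rfl

lemma apply_ne_zero (h : IsOuterTensor ιA ιB f) {m : M} {n : N} (hm : m ≠ 0) (hn : n ≠ 0) :
    f m n ≠ 0 := by
  intro h0
  have : m ⊗ₜ[k] n = 0 := h.isTensorProduct.1 (by simpa using h0)
  have h1 : Function.Injective (LinearMap.rTensor N (LinearMap.toSpanSingleton k M m)) :=
    Module.Flat.rTensor_preserves_injective_linearMap _ (smul_left_injective k hm)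
  have h2 : (1 : k) ⊗ₜ[k] n = 0 := h1 (by simpa using this)
  exact hn (by simpa using congrArg (TensorProduct.lid k N) h2)

end IsOuterTensor

lemma HasDepth.outerTensor_zero {mA : Ideal A} {mB : Ideal B} {b : ℕ}
    (h : IsOuterTensor ιA ιB f) (hM : HasDepth mA 0 M) (hN : HasDepth mB b N) :
    HasDepth (mA.map ιA ⊔ mB.map ιB) b T := by
  induction b generalizing N T with
  | zero =>
    obtain ⟨m, hm, hm'⟩ := hM
    obtain ⟨n, hn, hn'⟩ := hN
    refine ⟨f m n, h.apply_ne_zero hm hn, fun a ha => ?_⟩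
    have hle : mA.map ιA ⊔ mB.map ιB ≤ Submodule.annihilator (Submodule.span R {f m n}) := by
      refine sup_le (Ideal.map_le_iff_le_comap.mpr fun a ha => ?_)
        (Ideal.map_le_iff_le_comap.mpr fun b hb => ?_)
      · rw [Ideal.mem_comap, Submodule.mem_annihilator_span_singleton, ← h.map_smul_left, hm' a ha]
        simp
      · rw [Ideal.mem_comap, Submodule.mem_annihilator_span_singleton, ← h.map_smul_right, hn' b hb]
        simp
    exact (Submodule.mem_annihilator_span_singleton _ _).mp (hle ha)
  | succ b ih =>
    obtain ⟨x, hx, hreg, hN⟩ := hN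
    exact ⟨ιB x, Ideal.mem_sup_right (Ideal.mem_map_of_mem _ hx), h.flip.isSMulRegular hreg,
      ih (h.flip.quot x).flip hN⟩

lemma HasDepth.outerTensor {mA : Ideal A} {mB : Ideal B} {a b : ℕ}
    (h : IsOuterTensor ιA ιB f) (hM : HasDepth mA a M) (hN : HasDepth mB b N) :
    HasDepth (mA.map ιA ⊔ mB.map ιB) (a + b) T := by
  induction a generalizing M T with
  | zero => rw [zero_add]; exact HasDepth.outerTensor_zero h hM hN
  | succ a ih =>
    obtain ⟨x, hx, hreg, hM⟩ := hM
    rw [Nat.add_right_comm]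
    exact ⟨ιA x, Ideal.mem_sup_left (Ideal.mem_map_of_mem _ hx), h.isSMulRegular hreg,
      ih (h.quot x) hM⟩

end OuterTensor

section TensorIdeals

open TensorProduct

set_option linter.unusedSectionVars false

variable {k A B R : Type} [Field k] [CommRing A] [CommRing B] [CommRing R] [Algebra k A]
  [Algebra k B] [Algebra k R] (ιA : A →ₐ[k] R) (ιB : B →ₐ[k] R)

/-- The quotient map `p → p/p'` as a `k`-linear map. -/
def subQuotientMk (k : Type) [Field k] {A : Type} [CommRing A] [Algebra k A] (p p' : Ideal A) :
    ↥p →ₗ[k] SubQuotient p p' :=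
  (Submodule.mkQ (Submodule.comap p.subtype p')).restrictScalars k

lemma subQuotientMk_surjective (p p' : Ideal A) : Function.Surjective (subQuotientMk k p p') :=
  Submodule.mkQ_surjective (Submodule.comap p.subtype p')

lemma subQuotientMk_eq_zero {p p' : Ideal A} {x : p} :
    subQuotientMk k p p' x = 0 ↔ (x : A) ∈ p' :=
  Submodule.Quotient.mk_eq_zero (Submodule.comap p.subtype p')

def subQuotientLift {P : Type} [AddCommGroup P] [Module k P] (p p' : Ideal A) (g : ↥p →ₗ[k] P)
    (hg : ∀ x : p, (x : A) ∈ p' → g x = 0) : SubQuotient p p' →ₗ[k] P :=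
  Submodule.liftQ ((Submodule.comap p.subtype p').restrictScalars k) g (fun x hx => hg x hx) ∘ₗ
    (Submodule.Quotient.restrictScalarsEquiv k (Submodule.comap p.subtype p')).symm.toLinearMap

/-- The ideal generated by the products of elements of `p` and `q`. -/
abbrev mulIdeal (p : Ideal A) (q : Ideal B) : Ideal R := p.map ιA * q.map ιB

/-- The ideal generated by `p` and `q`. -/
abbrev addIdeal (p : Ideal A) (q : Ideal B) : Ideal R := p.map ιA ⊔ q.map ιB

/-- The multiplication `p × q → pq`. -/
def mulMap (p : Ideal A) (q : Ideal B) : ↥p →ₗ[k] ↥q →ₗ[k] ↥(mulIdeal ιA ιB p q) :=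
  LinearMap.mk₂ k (fun a b => ⟨ιA a * ιB b,
      Ideal.mul_mem_mul (Ideal.mem_map_of_mem ιA a.2) (Ideal.mem_map_of_mem ιB b.2)⟩)
    (fun a a' b => Subtype.ext (by simp [add_mul]))
    (fun c a b => Subtype.ext (by simp))
    (fun a b b' => Subtype.ext (by simp [mul_add]))
    (fun c a b => Subtype.ext (by simp))

lemma coe_mulMap (p : Ideal A) (q : Ideal B) (a : p) (b : q) :
    (mulMap ιA ιB p q a b : R) = ιA a * ιB b := rfl

lemma coe_lift_mulMap (p : Ideal A) (q : Ideal B) (w : p ⊗[k] q) :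
    (TensorProduct.lift (mulMap ιA ιB p q) w : R) =
      Algebra.TensorProduct.productMap ιA ιB
        (TensorProduct.map (p.subtype.restrictScalars k) (q.subtype.restrictScalars k) w) := by
  induction w with
  | zero => simp
  | tmul a b => simp [coe_mulMap]
  | add a b ha hb => simp [ha, hb]

variable {ιA ιB}

lemma lift_mulMap_surjective
    (hR : Function.Surjective (Algebra.TensorProduct.productMap ιA ιB)) (p : Ideal A)
    (q : Ideal B) : Function.Surjective (TensorProduct.lift (mulMap ιA ιB p q)) := by
  have hsmul : ∀ (r : R) (w : p ⊗[k] q), ∃ v : p ⊗[k] q,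
      (TensorProduct.lift (mulMap ιA ιB p q) v : R) =
        r * (TensorProduct.lift (mulMap ιA ιB p q) w : R) := by
    intro r w
    obtain ⟨z, rfl⟩ := hR r
    induction z with
    | zero => exact ⟨0, by simp⟩
    | add y z hy hz =>
      obtain ⟨v, hv⟩ := hy
      obtain ⟨v', hv'⟩ := hz
      exact ⟨v + v', by simp [hv, hv', add_mul]⟩
    | tmul a' b' =>
      induction w with
      | zero => exact ⟨0, by simp⟩
      | add y z hy hz =>
        obtain ⟨v, hv⟩ := hy
        obtain ⟨v', hv'⟩ := hz
        exact ⟨v + v', by simp [hv, hv', mul_add]⟩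
      | tmul a b =>
        refine ⟨(a' • a) ⊗ₜ (b' • b), ?_⟩
        simp [coe_mulMap]
        ring
  let S : Ideal R :=
    { carrier := {x | ∃ w, (TensorProduct.lift (mulMap ιA ιB p q) w : R) = x}
      zero_mem' := ⟨0, by simp⟩
      add_mem' := by
        rintro _ _ ⟨v, rfl⟩ ⟨w, rfl⟩
        exact ⟨v + w, by simp⟩
      smul_mem' := by
        rintro r _ ⟨w, rfl⟩
        exact hsmul r w }
  have hS : mulIdeal ιA ιB p q ≤ S := by
    rw [mulIdeal, Ideal.map, Ideal.map, Ideal.span_mul_span', Ideal.span_le]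
    rintro _ ⟨_, ⟨a, ha, rfl⟩, _, ⟨b, hb, rfl⟩, rfl⟩
    exact ⟨⟨a, ha⟩ ⊗ₜ ⟨b, hb⟩, by simp [coe_mulMap]⟩
  rintro ⟨x, hx⟩
  obtain ⟨w, hw⟩ := hS hx
  exact ⟨w, Subtype.ext hw⟩

lemma map_subQuotientMk_eq_zero
    (hR : Function.Bijective (Algebra.TensorProduct.productMap ιA ιB)) (p p' : Ideal A)
    (q q' : Ideal B) {w : p ⊗[k] q}
    (hw : (TensorProduct.lift (mulMap ιA ιB p q) w : R) ∈ addIdeal ιA ιB p' q') :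
    TensorProduct.map (subQuotientMk k p p') (subQuotientMk k q q') w = 0 := by
  let e := AlgEquiv.ofBijective _ hR
  let π : R →ₐ[k] (A ⧸ p') ⊗[k] (B ⧸ q') :=
    (Algebra.TensorProduct.map (Ideal.Quotient.mkₐ k p') (Ideal.Quotient.mkₐ k q')).comp
      e.symm.toAlgHom
  have hπ : ∀ z, π (Algebra.TensorProduct.productMap ιA ιB z) =
      Algebra.TensorProduct.map (Ideal.Quotient.mkₐ k p') (Ideal.Quotient.mkₐ k q') z := by
    intro z
    exact congrArg _ (e.symm_apply_apply z)
  have hker : addIdeal ιA ιB p' q' ≤ RingHom.ker π := by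
    refine sup_le (Ideal.map_le_iff_le_comap.mpr fun a ha => ?_)
        (Ideal.map_le_iff_le_comap.mpr fun b hb => ?_)
    · rw [Ideal.mem_comap, RingHom.mem_ker, ← Algebra.TensorProduct.productMap_left_apply ιA ιB a,
        hπ, Algebra.TensorProduct.map_tmul, Ideal.Quotient.mkₐ_eq_mk,
        Ideal.Quotient.eq_zero_iff_mem.mpr ha, zero_tmul]
    · rw [Ideal.mem_comap, RingHom.mem_ker, ← Algebra.TensorProduct.productMap_right_apply ιA ιB b,
        hπ, Algebra.TensorProduct.map_tmul, Ideal.Quotient.mkₐ_eq_mk k q',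
        Ideal.Quotient.eq_zero_iff_mem.mpr hb, tmul_zero]
  have h0 := hker hw
  rw [RingHom.mem_ker, coe_lift_mulMap, hπ] at h0
  refine map_injective_of_flat_flat ((subQuotientInclusion p p').restrictScalars k)
    ((subQuotientInclusion q q').restrictScalars k) (subQuotientInclusion_injective p p')
    (subQuotientInclusion_injective q q') ?_
  rw [map_zero, ← h0]
  clear h0 hw
  induction w with
  | zero => simp
  | tmul a b => rfl
  | add a b ha hb => simp only [map_add, ha, hb]

lemma mulIdeal_inf_addIdeal_le
    (hR : Function.Bijective (Algebra.TensorProduct.productMap ιA ιB)) (p p' : Ideal A)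
    (q q' : Ideal B) :
    mulIdeal ιA ιB p q ⊓ addIdeal ιA ιB p' q' ≤ mulIdeal ιA ιB p' q ⊔ mulIdeal ιA ιB p q' := by
  rintro x ⟨hx, hx'⟩
  obtain ⟨w, hw⟩ := lift_mulMap_surjective hR.2 p q ⟨x, hx⟩
  have hwx : (TensorProduct.lift (mulMap ιA ιB p q) w : R) = x := congrArg Subtype.val hw
  rw [← hwx] at hx' ⊢
  have h0 := map_subQuotientMk_eq_zero hR p p' q q' hx'
  have hp : Function.Exact ((Submodule.subtype (Submodule.comap p.subtype p')).restrictScalars k)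
      (subQuotientMk k p p') := LinearMap.exact_subtype_mkQ (Submodule.comap p.subtype p')
  have hq : Function.Exact ((Submodule.subtype (Submodule.comap q.subtype q')).restrictScalars k)
      (subQuotientMk k q q') := LinearMap.exact_subtype_mkQ (Submodule.comap q.subtype q')
  rw [← LinearMap.mem_ker, TensorProduct.map_ker hp (subQuotientMk_surjective p p') hq
    (subQuotientMk_surjective q q')] at h0
  obtain ⟨_, ⟨u, rfl⟩, _, ⟨v, rfl⟩, rfl⟩ := Submodule.mem_sup.mp h0
  rw [map_add, Submodule.coe_add, add_comm]
  refine Submodule.add_mem_sup ?_ ?_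
  · clear h0 hx' hwx hw
    induction v with
    | zero => simp
    | tmul a b =>
      exact Ideal.mul_mem_mul (Ideal.mem_map_of_mem ιA a.2) (Ideal.mem_map_of_mem ιB b.2)
    | add a b ha hb =>
      simp only [map_add, Submodule.coe_add]
      exact add_mem ha hb
  · clear h0 hx' hwx hw
    induction u with
    | zero => simp
    | tmul a b =>
      exact Ideal.mul_mem_mul (Ideal.mem_map_of_mem ιA a.2) (Ideal.mem_map_of_mem ιB b.2)
    | add a b ha hb =>
      simp only [map_add, Submodule.coe_add]
      exact add_mem ha hb

variable (ιA ιB)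

/-- The bilinear map `p × q → pq/(pq ∩ (p' + q'))`. -/
def mulMapMk (p p' : Ideal A) (q q' : Ideal B) :
    ↥p →ₗ[k] ↥q →ₗ[k] SubQuotient (mulIdeal ιA ιB p q) (addIdeal ιA ιB p' q') :=
  (mulMap ιA ιB p q).compr₂ (subQuotientMk k (mulIdeal ιA ιB p q) (addIdeal ιA ιB p' q'))

lemma mulMapMk_left_eq_zero (p p' : Ideal A) (q q' : Ideal B) {a : p} (ha : (a : A) ∈ p') (b : q) :
    mulMapMk ιA ιB p p' q q' a b = 0 :=
  (subQuotientMk_eq_zero (k := k) (x := mulMap ιA ιB p q a b)).mpr (Ideal.mem_sup_left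
    (show ιA a * ιB b ∈ p'.map ιA from Ideal.mul_mem_right _ _ (Ideal.mem_map_of_mem ιA ha)))

lemma mulMapMk_right_eq_zero (p p' : Ideal A) (q q' : Ideal B) (a : p) {b : q}
    (hb : (b : B) ∈ q') : mulMapMk ιA ιB p p' q q' a b = 0 :=
  (subQuotientMk_eq_zero (k := k) (x := mulMap ιA ιB p q a b)).mpr (Ideal.mem_sup_right
    (show ιA a * ιB b ∈ q'.map ιB from Ideal.mul_mem_left _ _ (Ideal.mem_map_of_mem ιB hb)))

/-- The bilinear map `q/q' × p → pq/(pq ∩ (p' + q'))`. -/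
def mulMapMkRight (p p' : Ideal A) (q q' : Ideal B) : SubQuotient q q' →ₗ[k] ↥p →ₗ[k]
    SubQuotient (mulIdeal ιA ιB p q) (addIdeal ιA ιB p' q') :=
  subQuotientLift q q' (mulMapMk ιA ιB p p' q q').flip
    (fun _ hb => LinearMap.ext fun a => mulMapMk_right_eq_zero ιA ιB p p' q q' a hb)

lemma mulMapMkRight_mk (p p' : Ideal A) (q q' : Ideal B) (a : p) (b : q) :
    mulMapMkRight ιA ιB p p' q q' (subQuotientMk k q q' b) a = mulMapMk ιA ιB p p' q q' a b := rfl

lemma mulMapMkRight_eq_zero (p p' : Ideal A) (q q' : Ideal B) {a : p} (ha : (a : A) ∈ p')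
    (y : SubQuotient q q') : mulMapMkRight ιA ιB p p' q q' y a = 0 := by
  obtain ⟨b, rfl⟩ := subQuotientMk_surjective (k := k) q q' y
  rw [mulMapMkRight_mk]
  exact mulMapMk_left_eq_zero ιA ιB p p' q q' ha b

/-- The bilinear map `p/p' × q/q' → pq/(pq ∩ (p' + q'))`. -/
def subQuotientMul (p p' : Ideal A) (q q' : Ideal B) :
    SubQuotient p p' →ₗ[k] SubQuotient q q' →ₗ[k]
      SubQuotient (mulIdeal ιA ιB p q) (addIdeal ιA ιB p' q') :=
  subQuotientLift p p' (mulMapMkRight ιA ιB p p' q q').flip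
    (fun _ ha => LinearMap.ext fun y => mulMapMkRight_eq_zero ιA ιB p p' q q' ha y)

lemma subQuotientMul_mk (p p' : Ideal A) (q q' : Ideal B) (a : p) (b : q) :
    subQuotientMul ιA ιB p p' q q' (subQuotientMk k p p' a) (subQuotientMk k q q' b) =
      subQuotientMk k _ _ (mulMap ιA ιB p q a b) := rfl

variable {ιA ιB}

lemma isOuterTensor_subQuotientMul
    (hR : Function.Bijective (Algebra.TensorProduct.productMap ιA ιB)) (p p' : Ideal A)
    (q q' : Ideal B) : IsOuterTensor ιA ιB (subQuotientMul ιA ιB p p' q q') where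
  isTensorProduct := by
    have key : ∀ w, TensorProduct.lift (subQuotientMul ιA ιB p p' q q')
        (TensorProduct.map (subQuotientMk k p p') (subQuotientMk k q q') w) =
        subQuotientMk k _ _ (TensorProduct.lift (mulMap ιA ιB p q) w) := by
      intro w
      induction w with
      | zero => simp
      | tmul a b => exact subQuotientMul_mk ιA ιB p p' q q' a b
      | add a b ha hb => simp only [map_add, ha, hb]
    constructor
    · rw [← LinearMap.ker_eq_bot, LinearMap.ker_eq_bot']
      intro z hz
      obtain ⟨w, rfl⟩ := TensorProduct.map_surjective (subQuotientMk_surjective p p')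
        (subQuotientMk_surjective q q') z
      rw [key] at hz
      exact map_subQuotientMk_eq_zero hR p p' q q' (subQuotientMk_eq_zero.mp hz)
    · intro t
      obtain ⟨t, rfl⟩ := subQuotientMk_surjective (k := k) _ _ t
      obtain ⟨w, rfl⟩ := lift_mulMap_surjective hR.2 p q t
      exact ⟨_, key w⟩
  map_smul_left c x y := by
    obtain ⟨a, rfl⟩ := subQuotientMk_surjective (k := k) _ _ x
    obtain ⟨b, rfl⟩ := subQuotientMk_surjective (k := k) _ _ y
    change subQuotientMk k _ _ (mulMap ιA ιB p q (c • a) b) =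
      subQuotientMk k _ _ (ιA c • mulMap ιA ιB p q a b)
    congr 1
    exact Subtype.ext (by simp [coe_mulMap, mul_assoc])
  map_smul_right c x y := by
    obtain ⟨a, rfl⟩ := subQuotientMk_surjective (k := k) _ _ x
    obtain ⟨b, rfl⟩ := subQuotientMk_surjective (k := k) _ _ y
    change subQuotientMk k _ _ (mulMap ιA ιB p q a (c • b)) =
      subQuotientMk k _ _ (ιB c • mulMap ιA ιB p q a b)
    congr 1
    exact Subtype.ext (by simp [coe_mulMap, mul_left_comm])

end TensorIdeals

section Decomposition

variable {R : Type} [CommRing R] {m : Ideal R}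

section

variable {M M' : Type} [AddCommGroup M] [Module R M] [AddCommGroup M'] [Module R M'] {d : ℕ}

lemma ExtMapZero.sum {ι : Type*} [Fintype ι] {φ : ι → M →ₗ[R] M'}
    (h : ∀ i, ExtMapZero m d (φ i)) : ExtMapZero m d (∑ i, φ i) := by
  intro α
  have : ModuleCat.ofHom (∑ i, φ i) = ∑ i, ModuleCat.ofHom (φ i) := by
    ext; simp
  rw [this, Ext.mk₀_sum, Ext.comp_sum]
  exact Finset.sum_eq_zero fun i _ => h i α

lemma extMapZero_id_iff : ExtMapZero m d (LinearMap.id : M →ₗ[R] M) ↔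
    Subsingleton (Ext (ModuleCat.of R (R ⧸ m)) (ModuleCat.of R M) d) := by
  constructor
  · refine fun h => subsingleton_of_forall_eq 0 fun α => ?_
    have := h α
    rwa [ModuleCat.ofHom_id, Ext.comp_mk₀_id] at this
  · exact fun h α => Subsingleton.elim _ _

lemma extVanish_iff_extMapZero {t : ℕ} :
    ExtVanish m M t ↔ ∀ i < t, ExtMapZero m i (LinearMap.id : M →ₗ[R] M) :=
  forall₂_congr fun _ _ => extMapZero_id_iff.symm

end

variable {ι : Type} [Fintype ι] {P P' : Ideal R} {X Z : ι → Ideal R}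

lemma extVanish_subQuotient_iff (hP : P = ⨆ s, X s) (hP' : ∀ s, P' ≤ Z s)
    (hXZ : ∀ s t, s ≠ t → X s ≤ Z t) (hinf : ∀ s, X s ⊓ Z s ≤ P') {t : ℕ} :
    ExtVanish m (SubQuotient P P') t ↔ ∀ s, ExtVanish m (SubQuotient (X s) (Z s)) t := by
  have hX : ∀ s, X s ≤ P := fun s => hP ▸ le_iSup X s
  let inc (s : ι) : SubQuotient (X s) (Z s) →ₗ[R] SubQuotient P P' :=
    Submodule.mapQ _ _ (Submodule.inclusion (hX s)) fun x hx => hinf s ⟨x.2, hx⟩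
  let e₀ (s : ι) : SubQuotient (X s) (Z s) →ₗ[R] SubQuotient P (Z s) :=
    Submodule.mapQ _ _ (Submodule.inclusion (hX s)) fun x hx => hx
  have he₀ : ∀ s, Function.Bijective (e₀ s) := by
    refine fun s => ⟨?_, ?_⟩
    · rw [injective_iff_map_eq_zero]
      intro x hx
      obtain ⟨x, rfl⟩ := Submodule.Quotient.mk_surjective _ x
      exact (Submodule.Quotient.mk_eq_zero (Submodule.comap (X s).subtype (Z s))).mpr
        ((Submodule.Quotient.mk_eq_zero (Submodule.comap P.subtype (Z s))).mp hx)
    · intro y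
      obtain ⟨⟨y, hy⟩, rfl⟩ := Submodule.Quotient.mk_surjective _ y
      have hle : P ≤ X s ⊔ Z s := by
        rw [hP]
        refine iSup_le fun u => ?_
        rcases eq_or_ne u s with rfl | hu
        exacts [le_sup_left, (hXZ u s hu).trans le_sup_right]
      obtain ⟨x, hx, z, hz, rfl⟩ := Submodule.mem_sup.mp (hle hy)
      refine ⟨Submodule.Quotient.mk ⟨x, hx⟩, ?_⟩
      refine (Submodule.Quotient.eq (Submodule.comap P.subtype (Z s))).mpr ?_
      change x - (x + z) ∈ Z s
      rw [sub_add_cancel_left]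
      exact neg_mem hz
  let e (s : ι) := LinearEquiv.ofBijective (e₀ s) (he₀ s)
  let proj₀ (s : ι) : SubQuotient P P' →ₗ[R] SubQuotient P (Z s) :=
    Submodule.factor (Submodule.comap_mono (hP' s))
  let proj (s : ι) : SubQuotient P P' →ₗ[R] SubQuotient (X s) (Z s) :=
    (e s).symm.toLinearMap ∘ₗ proj₀ s
  have hproj : ∀ s, proj s ∘ₗ inc s = LinearMap.id := by
    intro s
    ext x
    exact (e s).symm_apply_apply (Submodule.Quotient.mk x)
  have hproj' : ∀ s u (x : X u), s ≠ u → proj s (inc u (Submodule.Quotient.mk x)) = 0 := by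
    intro s u x hsu
    have : proj₀ s (inc u (Submodule.Quotient.mk x)) = 0 :=
      (Submodule.Quotient.mk_eq_zero (Submodule.comap P.subtype (Z s))).mpr (hXZ u s hsu.symm x.2)
    change (e s).symm _ = 0
    rw [this, map_zero]
  have hsum : ∑ s, inc s ∘ₗ proj s = LinearMap.id := by
    rw [← sub_eq_zero]
    set L := ∑ s, inc s ∘ₗ proj s - LinearMap.id with hL
    have hle : P ≤ Submodule.map P.subtype
        (LinearMap.ker (L ∘ₗ Submodule.mkQ (Submodule.comap P.subtype P'))) := by
      conv_lhs => rw [hP]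
      refine iSup_le fun u x hx => ⟨⟨x, hX u hx⟩, ?_, rfl⟩
      change L (inc u (Submodule.Quotient.mk ⟨x, hx⟩)) = 0
      rw [hL, LinearMap.sub_apply, LinearMap.sum_apply, Finset.sum_eq_single u]
      · rw [LinearMap.comp_apply, ← LinearMap.comp_apply (proj u), hproj]
        exact sub_self _
      · intro s _ hs
        rw [LinearMap.comp_apply, hproj' s u _ hs, map_zero]
      · simp
    ext ⟨y, hy⟩
    obtain ⟨y', hy', rfl⟩ := hle hy
    exact hy'
  simp only [extVanish_iff_extMapZero]
  constructor
  · intro h s i hi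
    have := (h i hi).comp (inc s) (proj s)
    rwa [LinearMap.id_comp, hproj] at this
  · intro h i hi
    rw [← hsum]
    refine ExtMapZero.sum fun s => ?_
    have := (h s i hi).comp (proj s) (inc s)
    rwa [LinearMap.id_comp] at this

end Decomposition

section GradedPiece

variable {k A B R : Type} [Field k] [CommRing A] [CommRing B] [CommRing R] [Algebra k A]
  [Algebra k B] [Algebra k R] {ιA : A →ₐ[k] R} {ιB : B →ₐ[k] R}

lemma add_pow_eq_iSup (U V : Ideal R) (n : ℕ) :
    (U + V) ^ n = ⨆ i : Fin (n + 1), U ^ (i : ℕ) * V ^ (n - i) := by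
  rw [add_pow, Finset.sum_range]
  simp only [Ideal.sum_eq_sup, Finset.sup_univ_eq_iSup]
  refine iSup_congr fun i => ?_
  have hne : n.choose i ≠ 0 := (Nat.choose_pos (by omega)).ne'
  rw [natCast_eq_one hne, mul_one]

lemma extVanish_gradedPiece_iff
    (hR : Function.Bijective (Algebra.TensorProduct.productMap ιA ιB)) {m : Ideal R} (I : Ideal A)
    (J : Ideal B) (n t : ℕ) :
    ExtVanish m (SubQuotient ((addIdeal ιA ιB I J) ^ n) ((addIdeal ιA ιB I J) ^ (n + 1))) t ↔
      ∀ i j, i + j = n → ExtVanish m (SubQuotient (mulIdeal ιA ιB (I ^ i) (J ^ j))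
        (addIdeal ιA ιB (I ^ (i + 1)) (J ^ (j + 1)))) t := by
  have hpow : ∀ n, addIdeal ιA ιB I J ^ n =
      ⨆ i : Fin (n + 1), mulIdeal ιA ιB (I ^ (i : ℕ)) (J ^ (n - i)) := by
    intro n
    simp only [mulIdeal, Ideal.map_pow]
    exact add_pow_eq_iSup _ _ n
  have hle : ∀ {a b i j : ℕ}, (i ≤ a ∨ j ≤ b) →
      mulIdeal ιA ιB (I ^ a) (J ^ b) ≤ addIdeal ιA ιB (I ^ i) (J ^ j) := by
    rintro a b i j (h | h)
    · have h1 : mulIdeal ιA ιB (I ^ a) (J ^ b) ≤ (I ^ a).map ιA := Ideal.mul_le_left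
      have h2 : (I ^ a).map ιA ≤ (I ^ i).map ιA := Ideal.map_mono (Ideal.pow_le_pow_right h)
      exact (h1.trans h2).trans le_sup_left
    · have h1 : mulIdeal ιA ιB (I ^ a) (J ^ b) ≤ (J ^ b).map ιB := Ideal.mul_le_right
      have h2 : (J ^ b).map ιB ≤ (J ^ j).map ιB := Ideal.map_mono (Ideal.pow_le_pow_right h)
      exact (h1.trans h2).trans le_sup_right
  have hle' : ∀ {a b c : ℕ}, a + b = c →
      mulIdeal ιA ιB (I ^ a) (J ^ b) ≤ addIdeal ιA ιB I J ^ c := by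
    rintro a b _ rfl
    rw [pow_add, mulIdeal, Ideal.map_pow, Ideal.map_pow]
    exact Ideal.mul_mono (Ideal.pow_right_mono le_sup_left a) (Ideal.pow_right_mono le_sup_right b)
  rw [extVanish_subQuotient_iff (hpow n) (Z := fun i : Fin (n + 1) =>
    addIdeal ιA ιB (I ^ ((i : ℕ) + 1)) (J ^ (n - i + 1)))]
  · constructor
    · intro h i j hij
      obtain rfl : j = n - i := by omega
      exact h ⟨i, by omega⟩
    · exact fun h i => h i (n - i) (by omega)
  · intro s
    rw [hpow]
    exact iSup_le fun u => hle (by omega)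
  · intro s u hsu
    have : (s : ℕ) ≠ u := fun h => hsu (Fin.ext h)
    exact hle (by omega)
  · intro s
    exact (mulIdeal_inf_addIdeal_le hR _ _ _ _).trans (sup_le (hle' (by omega)) (hle' (by omega)))

end GradedPiece

section Numerics

lemma eventually_min_add {a b c : ℕ → ℕ} {dA dB dC μA μB : ℕ}
    (ha : ∀ᶠ n in Filter.atTop, a n = dA) (hb : ∀ᶠ n in Filter.atTop, b n = dB)
    (hc : ∀ᶠ n in Filter.atTop, c n = dC) (hμA : ∀ t, t ≤ μA ↔ ∀ n, t ≤ a n)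
    (hμB : ∀ t, t ≤ μB ↔ ∀ n, t ≤ b n)
    (h : ∀ n t, t ≤ c n ↔ ∀ i j, i + j = n → t ≤ a i + b j) :
    dC = min (dA + μB) (μA + dB) := by
  obtain ⟨NA, hNA⟩ := Filter.eventually_atTop.mp ha
  obtain ⟨NB, hNB⟩ := Filter.eventually_atTop.mp hb
  obtain ⟨NC, hNC⟩ := Filter.eventually_atTop.mp hc
  have attained : ∀ {u : ℕ → ℕ} {μ : ℕ}, (∀ t, t ≤ μ ↔ ∀ n, t ≤ u n) → ∃ n, u n ≤ μ := by
    intro u μ hu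
    by_contra! hlt
    exact absurd ((hu (μ + 1)).mpr fun n => hlt n) (by omega)
  obtain ⟨i₀, hi₀⟩ := attained hμA
  obtain ⟨j₀, hj₀⟩ := attained hμB
  have hA : ∀ n, μA ≤ a n := (hμA μA).mp le_rfl
  have hB : ∀ n, μB ≤ b n := (hμB μB).mp le_rfl
  refine eq_of_forall_le_iff fun t => ?_
  rw [le_min_iff]
  constructor
  · intro ht
    constructor
    · have h1 := (h (NA + NC + j₀) t).mp (by rw [hNC _ (by omega)]; exact ht) (NA + NC) j₀ rfl
      rw [hNA _ (by omega)] at h1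
      omega
    · have h1 := (h (i₀ + (NB + NC)) t).mp (by rw [hNC _ (by omega)]; exact ht) i₀ (NB + NC) rfl
      rw [hNB _ (by omega)] at h1
      omega
  · rintro ⟨h1, h2⟩
    rw [← hNC (NA + NB + NC) (by omega), h]
    intro i j hij
    have hi := hA i
    have hj := hB j
    rcases le_or_gt NA i with hle | hlt
    · rw [hNA i hle]; omega
    · rw [hNB j (by omega)]; omega

end Numerics

section Polynomial

variable {k : Type} [Field k] {σ : Type}

lemma le_maxHomIdeal {I : Ideal (MvPolynomial σ k)} (hI : I ≠ ⊤) (hIh : IsHomogeneousIdeal k I) :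
    I ≤ maxHomIdeal k σ := by
  intro f hf
  rw [maxHomIdeal_eq, mem_ideal_span_X_image]
  intro m hm
  by_contra! hcon
  have hm0 : m = 0 := by
    ext i
    exact hcon i trivial
  subst hm0
  have h0 := hIh f hf 0
  rw [homogeneousComponent_zero] at h0
  refine hI (Ideal.eq_top_of_isUnit_mem _ h0 ?_)
  exact (isUnit_iff_ne_zero.mpr (mem_support_iff.mp hm)).map C

/-- The depths of `S/Q^n` and of `Q^n/Q^(n+1)`, their common limit, and the comparison of
their lower bounds. -/
lemma exists_depth_data [Finite σ] {Q : Ideal (MvPolynomial σ k)} (hQ : Q ≠ ⊥)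
    (hQm : Q ≤ maxHomIdeal k σ) :
    ∃ (a : ℕ → ℕ) (d : ℕ),
      (∀ n, HasDepth (maxHomIdeal k σ) (a n) (SubQuotient (Q ^ n) (Q ^ (n + 1)))) ∧
      (∀ᶠ n in Filter.atTop, a n = d) ∧
      (∀ᶠ n in Filter.atTop, depthQuot k (Q ^ n) = d) ∧
      ∀ t, t ≤ sInf {v : ℕ | ∃ n, 1 ≤ n ∧ v = depthQuot k (Q ^ n)} ↔ ∀ n, t ≤ a n := by
  have hm := maxHomIdeal_ne_top k σ
  choose a ha using exists_hasDepth_subQuotient_pow hm hQ hQm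
  obtain ⟨d, hd⟩ := exists_eventually_hasDepth_quotient_pow hm hQ hQm hasDepth_mvPolynomial
    (fun p d h => h.le_card)
  refine ⟨a, d, ha, hd.mono fun n hn => ?_, hd.mono fun n hn => hn.1.depthM_eq, fun t => ?_⟩
  · exact ExtDepth.unique (ha n).extDepth hn.2.extDepth
  have hq : ∀ n, n ≠ 0 → HasDepth (maxHomIdeal k σ) (depthQuot k (Q ^ n))
      (MvPolynomial σ k ⧸ Q ^ n) := by
    intro n hn
    obtain ⟨e, he⟩ := exists_hasDepth_quotient_pow hm hQm hn
    rwa [show depthQuot k (Q ^ n) = e from he.depthM_eq]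
  calc t ≤ sInf {v : ℕ | ∃ n, 1 ≤ n ∧ v = depthQuot k (Q ^ n)}
      ↔ ∀ n, n ≠ 0 → t ≤ depthQuot k (Q ^ n) := by
        have hne : {v : ℕ | ∃ n, 1 ≤ n ∧ v = depthQuot k (Q ^ n)}.Nonempty := ⟨_, 1, le_rfl, rfl⟩
        rw [le_csInf_iff (OrderBot.bddBelow _) hne]
        refine ⟨fun h n hn => h _ ⟨n, Nat.one_le_iff_ne_zero.mpr hn, rfl⟩, ?_⟩
        rintro h _ ⟨n, hn, rfl⟩
        exact h n (Nat.one_le_iff_ne_zero.mp hn)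
    _ ↔ ∀ n, n ≠ 0 → ExtVanish (maxHomIdeal k σ) (MvPolynomial σ k ⧸ Q ^ n) t :=
        forall₂_congr fun n hn => (hq n hn).extVanish_iff.symm
    _ ↔ ∀ n, t ≤ a n := extVanish_quotient_pow_iff.trans
        (forall_congr' fun n => (ha n).extVanish_iff)

variable (k)

lemma productMap_rename_bijective (σ τ : Type) :
    Function.Bijective (Algebra.TensorProduct.productMap
      (rename Sum.inl : MvPolynomial σ k →ₐ[k] MvPolynomial (σ ⊕ τ) k)
      (rename Sum.inr : MvPolynomial τ k →ₐ[k] MvPolynomial (σ ⊕ τ) k)) := by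
  let g : MvPolynomial (σ ⊕ τ) k →ₐ[k] TensorProduct k (MvPolynomial σ k) (MvPolynomial τ k) :=
    aeval (Sum.elim (fun i => X i ⊗ₜ[k] 1) (fun j => 1 ⊗ₜ[k] X j))
  have h1 : g.comp (Algebra.TensorProduct.productMap (rename Sum.inl) (rename Sum.inr)) =
      AlgHom.id k _ := by
    ext <;> simp [g]
  have h2 : (Algebra.TensorProduct.productMap (rename Sum.inl) (rename Sum.inr)).comp g =
      AlgHom.id k _ := by
    ext i : 1
    rcases i with i | i <;> simp [g]
  exact Function.bijective_iff_has_inverse.mpr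
    ⟨g, fun x => DFunLike.congr_fun h1 x, fun x => DFunLike.congr_fun h2 x⟩

lemma maxHomIdeal_sum (σ τ : Type) : maxHomIdeal k (σ ⊕ τ) =
    (maxHomIdeal k σ).map (rename Sum.inl : MvPolynomial σ k →ₐ[k] MvPolynomial (σ ⊕ τ) k) ⊔
      (maxHomIdeal k τ).map (rename Sum.inr : MvPolynomial τ k →ₐ[k] MvPolynomial (σ ⊕ τ) k) := by
  simp only [maxHomIdeal, Ideal.map_span]
  rw [← Ideal.span_union, ← Set.range_comp, ← Set.range_comp]
  congr 1
  ext x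
  simp [Sum.exists]

end Polynomial

end PaperHTT

open PaperHTT in
/-- Theorem 4.6: `lim_n depth R/(I+J)^n
= min (lim_i depth A/I^i + min_(j ≥ 1) depth B/J^j, min_(i ≥ 1) depth A/I^i + lim_j depth B/J^j)`
(all three limits exist by Brodmann's theorem). -/
theorem depth_limit_eq
    (k : Type) [Field k] (r s : ℕ)
    (I : Ideal (PA k r)) (J : Ideal (PB k s))
    (hI0 : I ≠ ⊥) (hI1 : I ≠ ⊤) (hIh : IsHomogeneousIdeal k I)
    (hJ0 : J ≠ ⊥) (hJ1 : J ≠ ⊤) (hJh : IsHomogeneousIdeal k J) :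
    ∃ dI dJ dS : ℕ,
      (∀ᶠ i in Filter.atTop, depthQuot k (I ^ i) = dI) ∧
      (∀ᶠ j in Filter.atTop, depthQuot k (J ^ j) = dJ) ∧
      (∀ᶠ n in Filter.atTop, depthQuot k ((sumIJ k I J) ^ n) = dS) ∧
      dS = min (dI + sInf {v : ℕ | ∃ j, 1 ≤ j ∧ v = depthQuot k (J ^ j)})
          (sInf {v : ℕ | ∃ i, 1 ≤ i ∧ v = depthQuot k (I ^ i)} + dJ) := by
  have hI := le_maxHomIdeal hI1 hIh
  have hJ := le_maxHomIdeal hJ1 hJh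
  obtain ⟨a, dI, ha, hadI, hI', hμA⟩ := exists_depth_data hI0 hI
  obtain ⟨b, dJ, hb, hbdJ, hJ', hμB⟩ := exists_depth_data hJ0 hJ
  have hQm : sumIJ k I J ≤ maxHomIdeal k (Fin r ⊕ Fin s) := by
    rw [maxHomIdeal_sum]
    exact sup_le_sup (Ideal.map_mono hI) (Ideal.map_mono hJ)
  have hQ0 : sumIJ k I J ≠ ⊥ := by
    obtain ⟨f, hf, hf0⟩ := Submodule.exists_mem_ne_zero_of_ne_bot hI0
    refine Submodule.ne_bot_iff _ |>.mpr ⟨rename Sum.inl f,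
      Ideal.mem_sup_left (Ideal.mem_map_of_mem _ hf), ?_⟩
    exact (map_ne_zero_iff _ (rename_injective _ Sum.inl_injective)).mpr hf0
  obtain ⟨c, dS, hc, hcdS, hS', -⟩ := exists_depth_data hQ0 hQm
  refine ⟨dI, dJ, dS, hI', hJ', hS', ?_⟩
  refine eventually_min_add hadI hbdJ hcdS hμA hμB fun n t => ?_
  rw [← (hc n).extVanish_iff]
  refine (extVanish_gradedPiece_iff (productMap_rename_bijective k (Fin r) (Fin s)) I J n t).trans
    (forall₂_congr fun i j => imp_congr_right fun _ => ?_)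
  rw [maxHomIdeal_sum]
  exact (HasDepth.outerTensor (isOuterTensor_subQuotientMul
    (productMap_rename_bijective k (Fin r) (Fin s)) _ _ _ _) (ha i) (hb j)).extVanish_iff
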